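/- arXiv:2207.08418 — 7 statements merged into one kernel-verified Lean document; each statement's English description precedes it below -/
import Mathlib

section
/- Let G be a closed subgroup of the unitary group U(n) of n×n complex matrices, with Haar probability measure μ, and let k, k' be natural numbers. For U ∈ U(n) let M(U) be the matrix indexed by functions I, J : {1,…,k+k'} → {1,…,n} with entries M(U)_{I,J} = ∏_{t=1}^{k} U_{I(t)J(t)} · ∏_{t=k+1}^{k+k'} conj(U_{I(t)J(t)}), and let Fix = {x : ({1,…,k+k'} → {1,…,n}) → ℂ such that M(U)x = x for all U ∈ G}. Suppose y_1, …, y_l is a basis of Fix, let g be the l×l Gram matrix g_{ij} = Σ_I conj(y_i(I)) y_j(I), and let W = g⁻¹. Then for all multi-indices I, J : {1,…,k+k'} → {1,…,n}: ∫_G M(U)_{I,J} dμ(U) = Σ_{i,j=1}^{l} W_{ij} · y_i(I) · conj(y_j(J)). -/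
open MeasureTheory
open scoped ComplexConjugate

/-- For `U ∈ U(n)`, the matrix `U^{⊗k} ⊗ conj(U)^{⊗k'}` acting on multi-indices. -/
noncomputable def tensorMatrix (n k k' : ℕ) (U : Matrix (Fin n) (Fin n) ℂ) :
    Matrix (Fin (k + k') → Fin n) (Fin (k + k') → Fin n) ℂ :=
  fun I J =>
    (∏ t : Fin k, U (I (Fin.castAdd k' t)) (J (Fin.castAdd k' t))) *
      ∏ t : Fin k', conj (U (I (Fin.natAdd k t)) (J (Fin.natAdd k t)))

/-- `U^{⊗k} ⊗ conj(U)^{⊗k'}` as a single product over all tensor legs. -/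
theorem tensorMatrix_eq_prod (n k k' : ℕ) (U : Matrix (Fin n) (Fin n) ℂ)
    (I J : Fin (k + k') → Fin n) :
    tensorMatrix n k k' U I J = ∏ t : Fin (k + k'),
      Fin.addCases (motive := fun _ => Matrix (Fin n) (Fin n) ℂ)
        (fun _ => U) (fun _ => U.map conj) t (I t) (J t) := by
  simp [tensorMatrix, Fin.prod_univ_add]

theorem tensorMatrix_mul (n k k' : ℕ) (U V : Matrix (Fin n) (Fin n) ℂ) :
    tensorMatrix n k k' (U * V) = tensorMatrix n k k' U * tensorMatrix n k k' V := by
  ext I J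
  simp only [Matrix.mul_apply, tensorMatrix_eq_prod, ← Finset.prod_mul_distrib]
  rw [← Fintype.prod_sum (fun t j =>
    Fin.addCases (motive := fun _ => Matrix (Fin n) (Fin n) ℂ)
        (fun _ => U) (fun _ => U.map conj) t (I t) j *
    Fin.addCases (motive := fun _ => Matrix (Fin n) (Fin n) ℂ)
        (fun _ => V) (fun _ => V.map conj) t j (J t))]
  refine Finset.prod_congr rfl fun t _ => ?_
  induction t using Fin.addCases <;> simp [Matrix.mul_apply]

theorem tensorMatrix_conjTranspose (n k k' : ℕ) (U : Matrix (Fin n) (Fin n) ℂ) :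
    tensorMatrix n k k' U.conjTranspose = (tensorMatrix n k k' U).conjTranspose := by
  ext I J
  simp [tensorMatrix, Matrix.conjTranspose_apply]

theorem norm_tensorMatrix_apply_le_one (n k k' : ℕ) (U : Matrix.unitaryGroup (Fin n) ℂ)
    (I J : Fin (k + k') → Fin n) : ‖tensorMatrix n k k' U I J‖ ≤ 1 := by
  have h : ∀ i j, ‖(U : Matrix (Fin n) (Fin n) ℂ) i j‖ ≤ 1 := entry_norm_bound_of_unitary U.2
  simp only [tensorMatrix, norm_mul, norm_prod, RCLike.norm_conj]
  exact mul_le_one₀ (Finset.prod_le_one (fun _ _ => norm_nonneg _) fun _ _ => h _ _)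
    (Finset.prod_nonneg fun _ _ => norm_nonneg _)
    (Finset.prod_le_one (fun _ _ => norm_nonneg _) fun _ _ => h _ _)

theorem continuous_tensorMatrix_apply (n k k' : ℕ) (I J : Fin (k + k') → Fin n) :
    Continuous fun U : Matrix (Fin n) (Fin n) ℂ => tensorMatrix n k k' U I J := by
  unfold tensorMatrix
  fun_prop

theorem integrable_tensorMatrix_apply (n k k' : ℕ) (G : Subgroup (Matrix.unitaryGroup (Fin n) ℂ))
    [MeasurableSpace ↥G] [BorelSpace ↥G] (μ : Measure ↥G) [IsFiniteMeasure μ]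
    (I J : Fin (k + k') → Fin n) :
    Integrable (fun U : ↥G => tensorMatrix n k k'
      ((U : Matrix.unitaryGroup (Fin n) ℂ) : Matrix (Fin n) (Fin n) ℂ) I J) μ := by
  refine Integrable.of_bound (C := 1) (Continuous.aestronglyMeasurable ?_)
    (Filter.Eventually.of_forall fun U => norm_tensorMatrix_apply_le_one n k k' U I J)
  exact (continuous_tensorMatrix_apply n k k' I J).comp
    (continuous_subtype_val.comp continuous_subtype_val)

/-- Weingarten's fundamental formula: if `G` is a closed subgroup of `U(n)` with Haar
probability measure `μ`, and `y 1, …, y l` is a basis of the space of fixed vectors of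
`U^{⊗k} ⊗ conj(U)^{⊗k'}`, `g` the Gram matrix of this basis and `W = g⁻¹`, then the
moments of the Haar measure are `∫ M(U)_{I,J} dμ = Σ_{i,j} W i j * y i I * conj (y j J)`. -/
theorem stmt1
    (n k k' l : ℕ)
    (G : Subgroup (Matrix.unitaryGroup (Fin n) ℂ))
    (hG : IsClosed (G : Set (Matrix.unitaryGroup (Fin n) ℂ)))
    [MeasurableSpace ↥G] [BorelSpace ↥G]
    (μ : Measure ↥G) [μ.IsHaarMeasure] [μ.IsMulRightInvariant] [IsProbabilityMeasure μ]
    (y : Fin l → ((Fin (k + k') → Fin n) → ℂ))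
    (hy_mem : ∀ i : Fin l, ∀ U : Matrix.unitaryGroup (Fin n) ℂ, U ∈ G →
      (tensorMatrix n k k' (U : Matrix (Fin n) (Fin n) ℂ)).mulVec (y i) = y i)
    (hy_span : ∀ x : (Fin (k + k') → Fin n) → ℂ,
      (∀ U : Matrix.unitaryGroup (Fin n) ℂ, U ∈ G →
        (tensorMatrix n k k' (U : Matrix (Fin n) (Fin n) ℂ)).mulVec x = x) →
      x ∈ Submodule.span ℂ (Set.range y))
    (hy_indep : LinearIndependent ℂ y)
    (g : Matrix (Fin l) (Fin l) ℂ)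
    (hg : ∀ i j : Fin l, g i j = ∑ I : Fin (k + k') → Fin n, conj (y i I) * y j I)
    (hg_inv : IsUnit g.det)
    (W : Matrix (Fin l) (Fin l) ℂ) (hW : W = g⁻¹) :
    ∀ I J : Fin (k + k') → Fin n,
      (∫ U : ↥G, tensorMatrix n k k'
          (((U : Matrix.unitaryGroup (Fin n) ℂ) : Matrix (Fin n) (Fin n) ℂ)) I J ∂μ) =
        ∑ i : Fin l, ∑ j : Fin l, W i j * y i I * conj (y j J) := by
  subst hW
  let M : ↥G → Matrix (Fin (k + k') → Fin n) (Fin (k + k') → Fin n) ℂ := fun U =>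
    tensorMatrix n k k' ((U : Matrix.unitaryGroup (Fin n) ℂ) : Matrix (Fin n) (Fin n) ℂ)
  have hint : ∀ I J, Integrable (fun U => M U I J) μ :=
    integrable_tensorMatrix_apply n k k' G μ
  have hmul : ∀ U V : ↥G, M (U * V) = M U * M V := fun U V => tensorMatrix_mul n k k' _ _
  have hinv : ∀ U : ↥G, M U⁻¹ = (M U).conjTranspose := fun U =>
    tensorMatrix_conjTranspose n k k' _
  let P : Matrix (Fin (k + k') → Fin n) (Fin (k + k') → Fin n) ℂ :=
    Matrix.of fun I J => ∫ U, M U I J ∂μ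
  let Y : Matrix (Fin (k + k') → Fin n) (Fin l) ℂ := Matrix.of fun I i => y i I
  have hMY : ∀ U : ↥G, M U * Y = Y := by
    intro U
    ext I i
    exact congrFun (hy_mem i U U.2) I
  have hYM : ∀ U : ↥G, Y.conjTranspose * M U = Y.conjTranspose := by
    intro U
    have h := congrArg Matrix.conjTranspose (hMY U⁻¹)
    rwa [Matrix.conjTranspose_mul, hinv, Matrix.conjTranspose_conjTranspose] at h
  have hMP : ∀ V : ↥G, M V * P = P := by
    intro V
    ext I J
    calc (M V * P) I J = ∑ K, ∫ U, M V I K * M U K J ∂μ := by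
          simp [P, Matrix.mul_apply, integral_const_mul]
      _ = ∫ U, M (V * U) I J ∂μ := by
          rw [← integral_finsetSum _ fun K _ => (hint K J).const_mul _]
          simp [hmul, Matrix.mul_apply]
      _ = P I J := integral_mul_left_eq_self (fun U => M U I J) V
  have hYP : Y.conjTranspose * P = Y.conjTranspose := by
    ext i J
    calc (Y.conjTranspose * P) i J = ∑ K, ∫ U, Y.conjTranspose i K * M U K J ∂μ := by
          simp [P, Matrix.mul_apply, integral_const_mul]
      _ = ∫ U, (Y.conjTranspose * M U) i J ∂μ := by
          rw [← integral_finsetSum _ fun K _ => (hint K J).const_mul _]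
          simp [Matrix.mul_apply]
      _ = Y.conjTranspose i J := by simp [hYM]
  have hcol : ∀ J, ∃ c : Fin l → ℂ, ∑ i, c i • y i = fun I => P I J := by
    intro J
    refine (Submodule.mem_span_range_iff_exists_fun ℂ).1 (hy_span _ fun U hU => ?_)
    ext I
    exact congrFun (congrFun (hMP ⟨U, hU⟩) I) J
  choose c hc using hcol
  let C : Matrix (Fin l) (Fin (k + k') → Fin n) ℂ := Matrix.of fun i J => c J i
  have hPC : P = Y * C := by
    ext I J
    rw [← congrFun (hc J) I]
    simp [Y, C, Matrix.mul_apply, mul_comm]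
  have hgY : g = Y.conjTranspose * Y := by
    ext i j
    simp [hg, Y, Matrix.mul_apply]
  have hC : C = g⁻¹ * Y.conjTranspose := by
    rw [← hYP, hPC, ← Matrix.mul_assoc Y.conjTranspose, ← hgY,
      Matrix.nonsing_inv_mul_cancel_left _ _ hg_inv]
  intro I J
  have h : P I J = (Y * (g⁻¹ * Y.conjTranspose)) I J := by rw [hPC, hC]
  refine h.trans ?_
  simp only [Matrix.mul_apply, Finset.mul_sum, Y, Matrix.of_apply, Matrix.conjTranspose_apply]
  refine Finset.sum_congr rfl fun i _ => Finset.sum_congr rfl fun j _ => ?_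
  rw [starRingEnd_apply]
  ring
end

section
/- Fix integers n, k ≥ 1. For a permutation σ of {1,…,k}, define E_σ : ({1,…,k} → {1,…,n}) × ({1,…,k} → {1,…,n}) → ℂ by E_σ(I,J) = 1 if I(t) = J(σ(t)) for all t, and E_σ(I,J) = 0 otherwise. Then a vector x : ({1,…,k} → {1,…,n}) × ({1,…,k} → {1,…,n}) → ℂ satisfies, for every unitary matrix U ∈ U(n) and all I, J, the fixed-point equation Σ_{I',J'} (∏_{t=1}^k U_{I(t)I'(t)}) (∏_{t=1}^k conj(U_{J(t)J'(t)})) x(I',J') = x(I,J), if and only if x lies in the complex linear span of {E_σ : σ ∈ S_k}. -/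
open scoped ComplexConjugate

/-- The vector `E_σ ∈ (ℂ^n)^{⊗k} ⊗ conj(ℂ^n)^{⊗k}` attached to a permutation `σ`. -/
noncomputable def Eperm (n k : ℕ) (σ : Equiv.Perm (Fin k)) :
    ((Fin k → Fin n) × (Fin k → Fin n)) → ℂ :=
  fun p => if ∀ t : Fin k, p.1 t = p.2 (σ t) then 1 else 0

section TensorInvariants

open Matrix MvPolynomial

lemma Equiv.Perm.exists_comp_eq_of_sum_single_eq {ι α : Type*} [Fintype ι] {f g : ι → α}
    (h : ∑ t, Finsupp.single (f t) 1 = (∑ t, Finsupp.single (g t) 1 : α →₀ ℕ)) :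
    ∃ σ : Equiv.Perm ι, g ∘ σ = f := by
  classical
  have hcard (a : α) : Fintype.card {t // f t = a} = Fintype.card {t // g t = a} := by
    have := DFunLike.congr_fun h a
    simpa [Finsupp.finsetSum_apply, Finsupp.single_apply, Fintype.card_subtype] using this
  exact ⟨Equiv.ofFiberEquiv fun a => Fintype.equivOfCardEq (hcard a),
    funext fun t => Equiv.ofFiberEquiv_map _ t⟩

lemma Complex.infinite_setOf_norm_eq_one : {z : ℂ | ‖z‖ = 1}.Infinite := by
  have : Infinite (Set.Ioc (-Real.pi) Real.pi) :=
    Set.infinite_coe_iff.2 (Set.Ioc_infinite (by linarith [Real.pi_pos]))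
  refine (Set.infinite_range_of_injective
    (Circle.coe_injective.comp Circle.argEquiv.symm.injective)).mono ?_
  rintro _ ⟨z, rfl⟩
  exact Circle.norm_coe _

/-- The unitary group is Zariski dense in the space of matrices. -/
theorem MvPolynomial.eq_zero_of_eval_unitaryGroup_eq_zero {m : Type*} [Fintype m] [DecidableEq m]
    (P : MvPolynomial (m × m) ℂ)
    (h : ∀ U ∈ unitaryGroup m ℂ, eval (fun p => U p.1 p.2) P = 0) : P = 0 := by
  have hdiag (V : unitaryGroup m ℂ) (d : m → ℂ) :
      eval (fun p => ((V : Matrix m m ℂ) * diagonal d * star (V : Matrix m m ℂ)) p.1 p.2) P = 0 := by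
    let Q : MvPolynomial m ℂ := bind₁
      (fun p : m × m => ∑ l, C ((V : Matrix m m ℂ) p.1 l * star ((V : Matrix m m ℂ) p.2 l)) * X l) P
    have hQ (d : m → ℂ) : eval d Q =
        eval (fun p => ((V : Matrix m m ℂ) * diagonal d * star (V : Matrix m m ℂ)) p.1 p.2) P := by
      simp only [Q, eval, eval₂Hom_bind₁]
      congr 2
      ext p
      simp [Matrix.mul_apply, diagonal_apply, mul_right_comm]
    rw [← hQ, show Q = 0 from ?_, map_zero]
    refine funext_set (fun _ => {z : ℂ | ‖z‖ = 1}) (fun _ => Complex.infinite_setOf_norm_eq_one)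
      fun d hd => ?_
    rw [hQ, map_zero]
    refine h _ (mul_mem (mul_mem V.2 ?_) (Unitary.star_mem V.2))
    rw [mem_unitaryGroup_iff, star_eq_conjTranspose, diagonal_conjTranspose, diagonal_mul_diagonal,
      ← diagonal_one]
    congr 1
    ext i
    have : ‖d i‖ = 1 := hd i trivial
    simp [Complex.mul_conj, Complex.normSq_eq_norm_sq, this]
  have hherm (A : Matrix m m ℂ) (hA : A.IsHermitian) : eval (fun p => A p.1 p.2) P = 0 := by
    have := hdiag hA.eigenvectorUnitary (RCLike.ofReal ∘ hA.eigenvalues)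
    rwa [← Unitary.conjStarAlgAut_apply (S := ℂ), ← hA.spectral_theorem] at this
  refine MvPolynomial.funext fun x => ?_
  rw [map_zero]
  let A : Matrix m m ℂ := of fun i j => x (i, j)
  let H : Matrix m m ℂ := (realPart A : Matrix m m ℂ)
  let K : Matrix m m ℂ := (imaginaryPart A : Matrix m m ℂ)
  let R : Polynomial ℂ := aeval
    (fun p : m × m => Polynomial.C (H p.1 p.2) + Polynomial.X * Polynomial.C (K p.1 p.2)) P
  have hR (z : ℂ) : R.eval z = eval (fun p => (H + z • K) p.1 p.2) P := by
    rw [← Polynomial.coe_evalRingHom, ← RingHom.coe_coe (Polynomial.evalRingHom z)]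
    simp only [R, aeval_def, eval]
    rw [RingHom.coe_coe, coe_eval₂Hom, MvPolynomial.hom_eval₂]
    congr 1
    · ext; simp
    · ext p
      rw [Matrix.add_apply, Matrix.smul_apply, smul_eq_mul, mul_comm z]
      simp
  have hR0 : R = 0 := by
    refine R.eq_zero_of_infinite_isRoot
      ((Set.infinite_range_of_injective Complex.ofReal_injective).mono ?_)
    rintro _ ⟨t, rfl⟩
    rw [Set.mem_ofPred_eq, Polynomial.IsRoot, hR]
    refine hherm _ ?_
    have hH : IsSelfAdjoint H := (realPart A).2
    have hK : IsSelfAdjoint K := (imaginaryPart A).2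
    exact hH.add (IsSelfAdjoint.smul (Complex.conj_ofReal t) hK)
  have := hR Complex.I
  rw [hR0, realPart_add_I_smul_imaginaryPart] at this
  simpa [A] using this.symm

variable {ι m : Type*} [Fintype ι] [Fintype m] [DecidableEq m]

/-- Permutation invariant tensors lie in the span of the tensor powers of unitaries: a linear
functional `c` vanishing on the latter vanishes on the former. -/
theorem sum_mul_eq_zero_of_unitaryGroup [DecidableEq ι] (c y : (ι → m) → (ι → m) → ℂ)
    (hc : ∀ U ∈ unitaryGroup m ℂ, ∑ I, ∑ J, c I J * ∏ t, U (I t) (J t) = 0)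
    (hy : ∀ (σ : Equiv.Perm ι) I J, y (I ∘ σ) (J ∘ σ) = y I J) :
    ∑ I, ∑ J, c I J * y I J = 0 := by
  let e (p : (ι → m) × (ι → m)) : m × m →₀ ℕ := ∑ t, Finsupp.single (p.1 t, p.2 t) 1
  let P : MvPolynomial (m × m) ℂ := ∑ p : (ι → m) × (ι → m), monomial (e p) (c p.1 p.2)
  have hP : P = 0 := by
    refine eq_zero_of_eval_unitaryGroup_eq_zero P fun U hU => ?_
    rw [← hc U hU, ← Fintype.sum_prod_type']
    simp only [P, e, map_sum, monomial_sum_index, map_mul, map_prod, eval_C]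
    refine Finset.sum_congr rfl fun p _ => congrArg _ (Finset.prod_congr rfl fun t _ => ?_)
    exact (eval_monomial ..).trans (by simp)
  rw [← Fintype.sum_prod_type', ← Finset.sum_fiberwise_of_maps_to
    (t := Finset.univ.image e) (g := e) fun p _ => Finset.mem_image_of_mem _ (Finset.mem_univ p)]
  refine Finset.sum_eq_zero fun a ha => ?_
  obtain ⟨q, -, rfl⟩ := Finset.mem_image.1 ha
  have hy' (p) (hp : e p = e q) : y p.1 p.2 = y q.1 q.2 := by
    obtain ⟨σ, hσ⟩ := Equiv.Perm.exists_comp_eq_of_sum_single_eq hp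
    rw [← hy σ q.1 q.2]
    congr 1 <;> ext t
    · exact (congrArg Prod.fst (congrFun hσ t)).symm
    · exact (congrArg Prod.snd (congrFun hσ t)).symm
  have hcoeff := congrArg (coeff (e q)) hP
  simp only [P, coeff_sum, coeff_monomial, coeff_zero] at hcoeff
  rw [Finset.sum_congr rfl fun p hp => by rw [hy' p (Finset.mem_filter.1 hp).2], ← Finset.sum_mul,
    Finset.sum_filter, hcoeff, zero_mul]

/-- The `ι`-th tensor power of a matrix. -/
def Matrix.tensorPow (ι : Type*) [Fintype ι] (A : Matrix m m ℂ) : Matrix (ι → m) (ι → m) ℂ :=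
  of fun I J => ∏ t, A (I t) (J t)

lemma Matrix.conjTranspose_tensorPow_mul_self [DecidableEq ι] {U : Matrix m m ℂ}
    (hU : U ∈ unitaryGroup m ℂ) : (tensorPow ι U)ᴴ * tensorPow ι U = 1 := by
  ext I J
  have h (a b : m) : ∑ i, star (U i a) * U i b = (1 : Matrix m m ℂ) a b := by
    rw [← mem_unitaryGroup_iff'.1 hU]
    simp [Matrix.mul_apply]
  simp only [Matrix.mul_apply, tensorPow, conjTranspose_apply, of_apply, star_prod,
    ← Finset.prod_mul_distrib]
  rw [← Fintype.prod_sum fun t i => star (U i (I t)) * U i (J t)]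
  simp only [h, Matrix.one_apply, Finset.prod_ite_zero, Finset.prod_const_one, funext_iff,
    Finset.mem_univ, true_imp_iff]

lemma Matrix.tensorPow_mul_conjTranspose_self [DecidableEq ι] {U : Matrix m m ℂ}
    (hU : U ∈ unitaryGroup m ℂ) : tensorPow ι U * (tensorPow ι U)ᴴ = 1 :=
  mul_eq_one_comm.1 (conjTranspose_tensorPow_mul_self hU)

/-- The averaging argument of Maschke's theorem, applied to the span of the permutation operators. -/
theorem mem_span_permutation_of_commute [DecidableEq ι] (x : (ι → m) → (ι → m) → ℂ)
    (hx : ∀ y : (ι → m) → (ι → m) → ℂ, (∀ (σ : Equiv.Perm ι) I J, y (I ∘ σ) (J ∘ σ) = y I J) →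
      ∀ I M, ∑ J, y I J * x J M = ∑ J, x I J * y J M) :
    (fun p : (ι → m) × (ι → m) => x p.1 p.2) ∈ Submodule.span ℂ (Set.range
      fun (σ : Equiv.Perm ι) (p : (ι → m) × (ι → m)) =>
        if ∀ t, p.1 t = p.2 (σ t) then (1 : ℂ) else 0) := by
  set E := fun (σ : Equiv.Perm ι) (p : (ι → m) × (ι → m)) =>
    if ∀ t, p.1 t = p.2 (σ t) then (1 : ℂ) else 0 with hE
  set N := Submodule.span ℂ (Set.range E)
  let L (σ : Equiv.Perm ι) : ((ι → m) × (ι → m) → ℂ) →ₗ[ℂ] ((ι → m) × (ι → m) → ℂ) :=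
    LinearMap.funLeft ℂ ℂ fun p => (p.1 ∘ σ, p.2)
  have hLL (σ τ w) : L σ (L τ w) = L (σ * τ) w := rfl
  have hLE (σ τ) : L σ (E τ) = E (τ * σ⁻¹) := by
    ext p
    simp only [L, LinearMap.funLeft_apply, hE, Function.comp_apply]
    congr 1
    rw [eq_iff_iff, ← (σ⁻¹).forall_congr_right]
    simp
  have hLN (σ) : N ≤ N.comap (L σ) := by
    rw [Submodule.span_le]
    rintro _ ⟨τ, rfl⟩
    rw [SetLike.mem_coe, Submodule.mem_comap, hLE]
    exact Submodule.subset_span ⟨_, rfl⟩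
  obtain ⟨π₀, hπ₀⟩ := N.subtype.exists_leftInverse_of_injective N.ker_subtype
  have hπ₀ (w) (hw : w ∈ N) : (π₀ w : (ι → m) × (ι → m) → ℂ) = w :=
    congrArg Subtype.val (LinearMap.congr_fun hπ₀ ⟨w, hw⟩)
  let π : ((ι → m) × (ι → m) → ℂ) →ₗ[ℂ] ((ι → m) × (ι → m) → ℂ) :=
    (Fintype.card (Equiv.Perm ι) : ℂ)⁻¹ • ∑ σ, L σ ∘ₗ N.subtype ∘ₗ π₀ ∘ₗ L σ⁻¹
  have hπ (w) : π w = (Fintype.card (Equiv.Perm ι) : ℂ)⁻¹ • ∑ σ, L σ (π₀ (L σ⁻¹ w)) := by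
    simp [π]
  have hπN (w) : π w ∈ N := by
    rw [hπ]
    exact N.smul_mem _ (N.sum_mem fun σ _ => hLN σ (π₀ _).2)
  have hπid (w) (hw : w ∈ N) : π w = w := by
    have hσ (σ : Equiv.Perm ι) : L σ (π₀ (L σ⁻¹ w)) = w := by
      rw [hπ₀ _ (hLN _ hw), hLL, mul_inv_cancel]
      rfl
    simp [hπ, hσ, ← Nat.cast_smul_eq_nsmul ℂ, smul_smul]
  have hπL (τ w) : π (L τ w) = L τ (π w) := by
    rw [hπ, hπ, map_smul, map_sum, ← Equiv.sum_comp (Equiv.mulLeft τ)]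
    simp [hLL, mul_assoc]
  have hπsum (w) (p) : π w p = ∑ b, ∑ J, π (Pi.single (J, b) 1) p * w (J, b) := by
    conv_lhs => rw [pi_eq_sum_univ' w]
    rw [map_sum, Finset.sum_apply, Fintype.sum_prod_type, Finset.sum_comm]
    simp [mul_comm]
  have hone : E 1 ∈ N := Submodule.subset_span ⟨1, rfl⟩
  have hE1 (J b : ι → m) : E 1 (J, b) = if J = b then 1 else 0 :=
    if_congr _root_.funext_iff.symm rfl rfl
  have hK (a b : ι → m) (σ : Equiv.Perm ι) (I J : ι → m) :
      π (Pi.single (J ∘ σ, b) 1) (I ∘ σ, a) = π (Pi.single (J, b) 1) (I, a) := by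
    have hs : L σ (Pi.single (J ∘ σ, b) 1) = Pi.single (J, b) 1 := by
      ext p
      have : p.1 ∘ σ = J ∘ σ ↔ p.1 = J := σ.surjective.injective_comp_right.eq_iff
      simp [L, LinearMap.funLeft_apply, Pi.single_apply, Prod.ext_iff, this]
    rw [← hs, hπL]
    rfl
  suffices π (fun p => x p.1 p.2) = fun p => x p.1 p.2 from this ▸ hπN _
  ext ⟨I, a⟩
  rw [hπsum]
  simp_rw [hx (fun I J => π (Pi.single (J, _) 1) (I, a)) (hK a _)]
  rw [Finset.sum_comm]
  simp_rw [← Finset.mul_sum]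
  have hone' (J) : ∑ b, π (Pi.single (b, b) 1) (J, a) = if J = a then 1 else 0 := by
    rw [← hE1, ← hπid _ hone, hπsum]
    simp [hE1]
  simp [hone']

end TensorInvariants


/-- Schur–Weyl duality / invariant vectors for the unitary group: a vector of
`(ℂ^n)^{⊗k} ⊗ conj(ℂ^n)^{⊗k}` is invariant under `U^{⊗k} ⊗ conj(U)^{⊗k}` for every
unitary `U` if and only if it lies in the span of the permutation vectors `E_σ`, `σ ∈ S_k`. -/
theorem stmt2 (n k : ℕ) (hn : 1 ≤ n) (hk : 1 ≤ k)
    (x : ((Fin k → Fin n) × (Fin k → Fin n)) → ℂ) :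
    (∀ U : Matrix.unitaryGroup (Fin n) ℂ, ∀ I J : Fin k → Fin n,
        ∑ I' : Fin k → Fin n, ∑ J' : Fin k → Fin n,
          (∏ t : Fin k, (U : Matrix (Fin n) (Fin n) ℂ) (I t) (I' t)) *
            (∏ t : Fin k, conj ((U : Matrix (Fin n) (Fin n) ℂ) (J t) (J' t))) *
              x (I', J') = x (I, J)) ↔
      x ∈ Submodule.span ℂ (Set.range (Eperm n k)) := by
  have hfix (U : Matrix (Fin n) (Fin n) ℂ) (I J) :
      ∑ I' : Fin k → Fin n, ∑ J' : Fin k → Fin n,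
        (∏ t : Fin k, U (I t) (I' t)) * (∏ t : Fin k, conj (U (J t) (J' t))) * x (I', J') =
      (U.tensorPow (Fin k) * Matrix.of (fun I J => x (I, J)) * (U.tensorPow (Fin k)).conjTranspose)
        I J := by
    simp only [Matrix.mul_apply, Matrix.tensorPow, Matrix.conjTranspose_apply, Matrix.of_apply,
      Finset.sum_mul, star_prod]
    rw [Finset.sum_comm]
    refine Finset.sum_congr rfl fun _ _ => Finset.sum_congr rfl fun _ _ => ?_
    rw [mul_right_comm]
    rfl
  constructor
  · intro h
    suffices hx : ∀ y : (Fin k → Fin n) → (Fin k → Fin n) → ℂ,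
        (∀ (σ : Equiv.Perm (Fin k)) I J, y (I ∘ σ) (J ∘ σ) = y I J) →
        ∀ I M, ∑ J, y I J * x (J, M) = ∑ J, x (I, J) * y J M by
      have := mem_span_permutation_of_commute (fun I J => x (I, J)) hx
      unfold Eperm
      convert! this
    intro y hy I M
    have hcomm (U) (hU : U ∈ Matrix.unitaryGroup (Fin n) ℂ) :
        U.tensorPow (Fin k) * Matrix.of (fun I J => x (I, J)) =
          Matrix.of (fun I J => x (I, J)) * U.tensorPow (Fin k) := by
      have : U.tensorPow (Fin k) * Matrix.of (fun I J => x (I, J)) *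
          (U.tensorPow (Fin k)).conjTranspose = Matrix.of (fun I J => x (I, J)) := by
        ext I J
        rw [← hfix]
        exact h ⟨U, hU⟩ I J
      conv_rhs => rw [← this]
      rw [mul_assoc, Matrix.conjTranspose_tensorPow_mul_self hU, mul_one]
    have key (z : (Fin k → Fin n) → (Fin k → Fin n) → ℂ) :
        ∑ I', ∑ J', ((if I' = I then x (J', M) else 0) - if J' = M then x (I, I') else 0) * z I' J' =
          ∑ J, z I J * x (J, M) - ∑ J, x (I, J) * z J M := by
      simp only [sub_mul, Finset.sum_sub_distrib, ite_mul, zero_mul]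
      congr 1
      · rw [Finset.sum_comm]
        simp [mul_comm]
      · simp
    rw [← sub_eq_zero, ← key]
    refine sum_mul_eq_zero_of_unitaryGroup _ y (fun U hU => ?_) hy
    rw [key fun I J => ∏ t, U (I t) (J t), sub_eq_zero]
    exact congrFun (congrFun (hcomm U hU) I) M
  · intro hx U I J
    rw [hfix]
    suffices (U : Matrix (Fin n) (Fin n) ℂ).tensorPow (Fin k) * Matrix.of (fun I J => x (I, J)) =
        Matrix.of (fun I J => x (I, J)) * (U : Matrix (Fin n) (Fin n) ℂ).tensorPow (Fin k) by
      rw [this, mul_assoc, Matrix.tensorPow_mul_conjTranspose_self U.2, mul_one]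
      rfl
    clear hfix I J
    ext I M
    simp only [Matrix.mul_apply, Matrix.of_apply]
    induction hx using Submodule.span_induction with
    | mem x hx =>
      obtain ⟨σ, rfl⟩ := hx
      have hl (J : Fin k → Fin n) : (∀ t, J t = M (σ t)) ↔ J = M ∘ σ := funext_iff.symm
      have hr (J : Fin k → Fin n) : (∀ t, I t = J (σ t)) ↔ J = I ∘ (σ⁻¹ : Equiv.Perm (Fin k)) := by
        rw [funext_iff, ← (σ⁻¹).forall_congr_right]
        simp [eq_comm]
      simp only [Eperm, hl, hr, mul_ite, ite_mul, mul_one, one_mul, mul_zero, zero_mul,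
        Finset.sum_ite_eq', Finset.mem_univ, if_true, Matrix.tensorPow, Matrix.of_apply]
      rw [← Equiv.prod_comp σ fun t =>
        (U : Matrix (Fin n) (Fin n) ℂ) ((I ∘ (σ⁻¹ : Equiv.Perm _)) t) (M t)]
      simp
    | zero => simp
    | add x y _ _ ihx ihy =>
      simp only [Pi.add_apply, mul_add, add_mul, Finset.sum_add_distrib, ihx, ihy]
    | smul a x _ ihx =>
      simp only [Pi.smul_apply, smul_eq_mul, mul_left_comm _ a, mul_assoc a, ← Finset.mul_sum, ihx]
end

section
/- Fix integers n, k ≥ 1. For a fixed-point-free involution π of {1,…,k} (i.e., a permutation with π∘π = id and π(t) ≠ t for all t), define E_π : ({1,…,k} → {1,…,n}) → ℂ by E_π(I) = 1 if I(t) = I(π(t)) for all t, and E_π(I) = 0 otherwise. Then a vector x : ({1,…,k} → {1,…,n}) → ℂ satisfies, for every real orthogonal matrix O ∈ O(n) and every I, the fixed-point equation Σ_J (∏_{t=1}^k O_{I(t)J(t)}) x(J) = x(I), if and only if x lies in the complex linear span of {E_π : π a fixed-point-free involution of {1,…,k}}. In particular, when k is odd the only such vector is x = 0. -/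
/-- The vector `E_π ∈ (ℂ^n)^{⊗k}` attached to a pair partition (fixed-point-free
involution) `π` of `{1,…,k}`. -/
noncomputable def EpairPartition (n k : ℕ) (π : Equiv.Perm (Fin k)) :
    (Fin k → Fin n) → ℂ :=
  fun I => if ∀ t : Fin k, I t = I (π t) then 1 else 0

/-- Invariance of a tensor under the diagonal action of the real orthogonal group. -/
def IsOrthogonalInvariant {n k : ℕ} (x : (Fin k → Fin n) → ℂ) : Prop :=
  ∀ O : Matrix.orthogonalGroup (Fin n) ℝ, ∀ I : Fin k → Fin n,
    ∑ J : Fin k → Fin n,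
      (∏ t : Fin k, (((O : Matrix (Fin n) (Fin n) ℝ) (I t) (J t) : ℝ) : ℂ)) * x J = x I

/-- The polarization operator replacing an index `a` by `b`, summed over all positions. -/
def polarize {n k : ℕ} (a b : Fin n) (x : (Fin k → Fin n) → ℂ) : (Fin k → Fin n) → ℂ :=
  fun I => ∑ t, if I t = a then x (Function.update I t b) else 0

/-- Contraction of a tensor in its first two positions. -/
def contractFirst {n m : ℕ} (x : (Fin (m + 2) → Fin n) → ℂ) : (Fin m → Fin n) → ℂ :=
  fun I => ∑ c, x (Fin.cons c (Fin.cons c I))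

theorem orthogonalGroup_sum_mul {n : ℕ} (O : Matrix.orthogonalGroup (Fin n) ℝ) (i j : Fin n) :
    ∑ c, ((O.1 i c : ℝ) : ℂ) * ((O.1 j c : ℝ) : ℂ) = if i = j then 1 else 0 := by
  have h := congrFun (congrFun ((Matrix.mem_orthogonalGroup_iff (Fin n) ℝ).1 O.2) i) j
  rw [Matrix.mul_apply, Matrix.one_apply] at h
  simp only [Matrix.transpose_apply] at h
  rw [← Complex.ofReal_one, ← Complex.ofReal_zero, ← apply_ite Complex.ofReal, ← h]
  push_cast
  rfl

theorem orthogonalGroup_sum_mul' {n : ℕ} (O : Matrix.orthogonalGroup (Fin n) ℝ) (i j : Fin n) :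
    ∑ c, ((O.1 c i : ℝ) : ℂ) * ((O.1 c j : ℝ) : ℂ) = if i = j then 1 else 0 := by
  have h := congrFun (congrFun ((Matrix.mem_orthogonalGroup_iff' (Fin n) ℝ).1 O.2) i) j
  change (O.1.transpose * O.1) i j = _ at h
  rw [Matrix.mul_apply, Matrix.one_apply] at h
  simp only [Matrix.transpose_apply] at h
  rw [← Complex.ofReal_one, ← Complex.ofReal_zero, ← apply_ite Complex.ofReal, ← h]
  push_cast
  rfl

theorem sum_fin_cons {n m : ℕ} (f : (Fin (m + 1) → Fin n) → ℂ) :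
    ∑ I, f I = ∑ c, ∑ I : Fin m → Fin n, f (Fin.cons c I) := by
  rw [← (Fin.consEquiv (fun _ : Fin (m + 1) => Fin n)).sum_comp, Fintype.sum_prod_type]
  rfl

theorem isOrthogonalInvariant_contractFirst {n m : ℕ} {x : (Fin (m + 2) → Fin n) → ℂ}
    (hx : IsOrthogonalInvariant x) : IsOrthogonalInvariant (contractFirst x) := by
  intro O I
  unfold contractFirst
  simp_rw [← hx O (Fin.cons _ (Fin.cons _ I)), sum_fin_cons, Fin.prod_univ_succ]
  simp only [Fin.cons_zero, Fin.cons_succ]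
  symm
  rw [Finset.sum_comm]
  calc _ = ∑ d, ∑ e, (∑ c, ((O.1 c d : ℝ) : ℂ) * ((O.1 c e : ℝ) : ℂ)) *
        ∑ J : Fin m → Fin n, (∏ t, ((O.1 (I t) (J t) : ℝ) : ℂ)) *
          x (Fin.cons d (Fin.cons e J)) := by
        refine Finset.sum_congr rfl fun d _ => ?_
        rw [Finset.sum_comm]
        refine Finset.sum_congr rfl fun e _ => ?_
        rw [Finset.sum_mul]
        refine Finset.sum_congr rfl fun c _ => ?_
        rw [Finset.mul_sum]
        refine Finset.sum_congr rfl fun J _ => ?_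
        ring
    _ = _ := by
        simp only [orthogonalGroup_sum_mul', ite_mul, one_mul, zero_mul, Finset.sum_ite_eq,
          Finset.mem_univ, if_true]
        rw [Finset.sum_comm]
        simp only [Finset.mul_sum]

theorem IsOrthogonalInvariant.comp_perm {n k : ℕ} {x : (Fin k → Fin n) → ℂ}
    (hx : IsOrthogonalInvariant x) (σ : Equiv.Perm (Fin k)) :
    IsOrthogonalInvariant fun I => x (I ∘ σ) := by
  intro O I
  dsimp only
  rw [← hx O (I ∘ σ), ← (σ.arrowCongr (Equiv.refl (Fin n))).sum_comp]
  refine Finset.sum_congr rfl fun J _ => ?_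
  rw [← Equiv.prod_comp σ]
  congr 1
  · simp
  · congr 1
    ext t
    simp

theorem IsOrthogonalInvariant.add {n k : ℕ} {x y : (Fin k → Fin n) → ℂ}
    (hx : IsOrthogonalInvariant x) (hy : IsOrthogonalInvariant y) :
    IsOrthogonalInvariant (x + y) := by
  intro O I
  simp only [Pi.add_apply, mul_add, Finset.sum_add_distrib]
  rw [hx O I, hy O I]

theorem IsOrthogonalInvariant.smul {n k : ℕ} {x : (Fin k → Fin n) → ℂ}
    (hx : IsOrthogonalInvariant x) (c : ℂ) : IsOrthogonalInvariant (c • x) := by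
  intro O I
  simp only [Pi.smul_apply, smul_eq_mul, mul_left_comm _ c, ← Finset.mul_sum]
  rw [hx O I]

theorem isOrthogonalInvariant_EpairPartition {n k : ℕ} {π : Equiv.Perm (Fin k)}
    (hπ : π * π = 1) (hfix : ∀ t, π t ≠ t) : IsOrthogonalInvariant (EpairPartition n k π) := by
  have hinv (t) : π (π t) = t := DFunLike.congr_fun hπ t
  let R := {t : Fin k // t < π t}
  let f : R ⊕ R → Fin k := Sum.elim (fun r => r.1) (fun r => π r.1)
  have hf : Function.Bijective f := by
    constructor
    · rintro (⟨r, hr⟩ | ⟨r, hr⟩) (⟨s, hs⟩ | ⟨s, hs⟩) h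
      · simp only [f, Sum.elim_inl] at h
        subst h; rfl
      · simp only [f, Sum.elim_inl, Sum.elim_inr] at h
        subst h
        rw [hinv] at hr
        exact absurd hr hs.not_gt
      · simp only [f, Sum.elim_inl, Sum.elim_inr] at h
        subst h
        rw [hinv] at hs
        exact absurd hr hs.not_gt
      · simp only [f, Sum.elim_inr, π.injective.eq_iff] at h
        subst h; rfl
    · intro t
      rcases lt_or_gt_of_ne (hfix t) with h | h
      · exact ⟨Sum.inr ⟨π t, by rwa [hinv]⟩, hinv t⟩
      · exact ⟨Sum.inl ⟨t, h⟩, rfl⟩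
  let e : R ⊕ R ≃ Fin k := Equiv.ofBijective f hf
  have hE (J : Fin k → Fin n) : EpairPartition n k π J =
      if (fun r : R => J r.1) = (fun r : R => J (π r.1)) then 1 else 0 := by
    unfold EpairPartition
    congr 1
    rw [eq_iff_iff, funext_iff]
    refine ⟨fun h r => h r.1, fun h t => ?_⟩
    rcases lt_or_gt_of_ne (hfix t) with h' | h'
    · have := h ⟨π t, by rwa [hinv]⟩
      simp only [hinv] at this
      exact this.symm
    · exact h ⟨t, h'⟩
  let g : (R → Fin n) × (R → Fin n) ≃ (Fin k → Fin n) :=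
    (Equiv.sumArrowEquivProdArrow R R (Fin n)).symm.trans (e.arrowCongr (Equiv.refl _))
  have hg₁ (p) (r : R) : g p r.1 = p.1 r := by
    have : e.symm r.1 = Sum.inl r := e.symm_apply_eq.2 rfl
    simp [g, this, Equiv.sumArrowEquivProdArrow]
  have hg₂ (p) (r : R) : g p (π r.1) = p.2 r := by
    have : e.symm (π r.1) = Sum.inr r := e.symm_apply_eq.2 rfl
    simp [g, this, Equiv.sumArrowEquivProdArrow]
  intro O I
  rw [← g.sum_comp, Fintype.sum_prod_type]
  simp only [hE, ← e.prod_comp, Fintype.prod_sum_type]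
  have he₁ (r : R) : e (Sum.inl r) = r.1 := rfl
  have he₂ (r : R) : e (Sum.inr r) = π r.1 := rfl
  simp only [he₁, he₂, hg₁, hg₂, mul_ite, mul_one, mul_zero, Finset.sum_ite_eq, Finset.mem_univ,
    if_true, ← Finset.prod_mul_distrib]
  rw [← Fintype.prod_sum (fun (r : R) c =>
    ((O.1 (I r.1) c : ℝ) : ℂ) * ((O.1 (I (π r.1)) c : ℝ) : ℂ))]
  simp only [orthogonalGroup_sum_mul]
  rw [Fintype.prod_ite_zero]
  simp [funext_iff]

theorem IsOrthogonalInvariant.polarize_comm {n k : ℕ} {x : (Fin k → Fin n) → ℂ}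
    (hx : IsOrthogonalInvariant x) (a b : Fin n) : polarize a b x = polarize b a x := by
  rcases eq_or_ne a b with rfl | hab
  · rfl
  let L : Matrix (Fin n) (Fin n) ℝ := Matrix.single a b 1 - Matrix.single b a 1
  have hLt : L.transpose = -L := by simp [L]
  have hL3 : L * L * L = -L := by
    simp [L, sub_mul, mul_sub, hab, hab.symm]
    abel
  let R : ℝ → Matrix (Fin n) (Fin n) ℝ := fun θ =>
    1 + Real.sin θ • L + (1 - Real.cos θ) • (L * L)
  have hR (θ) : R θ ∈ Matrix.orthogonalGroup (Fin n) ℝ := by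
    rw [Matrix.mem_orthogonalGroup_iff]
    have hL4 : L * L * (L * L) = -(L * L) := by rw [← mul_assoc, hL3, neg_mul]
    have hL3' : L * (L * L) = -L := by rw [← mul_assoc, hL3]
    simp only [R, Matrix.transpose_add, Matrix.transpose_smul, Matrix.transpose_mul, hLt,
      Matrix.transpose_one, neg_mul, neg_neg, mul_add, add_mul, one_mul, mul_one, smul_mul_assoc,
      mul_smul_comm, mul_neg, hL4, hL3, hL3', smul_neg]
    match_scalars
    · simp
    · ring
    · ring
    · linear_combination -(Real.sin_sq_add_cos_sq θ)
  have hderiv (i j) : HasDerivAt (fun θ => ((R θ i j : ℝ) : ℂ)) (L i j : ℂ) 0 := by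
    have h : HasDerivAt (fun θ => R θ i j) (L i j) 0 := by
      have h1 := ((Real.hasDerivAt_sin 0).mul_const (L i j)).const_add
        ((1 : Matrix (Fin n) (Fin n) ℝ) i j)
      have h2 := ((Real.hasDerivAt_cos 0).const_sub 1).mul_const ((L * L) i j)
      have h3 := h1.add h2
      simp only [Real.cos_zero, Real.sin_zero, neg_zero, one_mul, zero_mul, add_zero] at h3
      exact h3
    exact h.ofReal_comp
  have hR0 (i j) : R 0 i j = (1 : Matrix (Fin n) (Fin n) ℝ) i j := by simp [R]
  funext I
  have hsum : HasDerivAt (fun θ => ∑ J : Fin k → Fin n,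
      (∏ t, ((R θ (I t) (J t) : ℝ) : ℂ)) * x J)
      (∑ J : Fin k → Fin n, (∑ t, (∏ s ∈ Finset.univ.erase t, ((R 0 (I s) (J s) : ℝ) : ℂ)) •
        (L (I t) (J t) : ℂ)) * x J) 0 :=
    HasDerivAt.fun_sum fun J _ =>
      (HasDerivAt.fun_finsetProd fun t _ => hderiv (I t) (J t)).mul_const (x J)
  have hconst : (fun θ => ∑ J : Fin k → Fin n, (∏ t, ((R θ (I t) (J t) : ℝ) : ℂ)) * x J) =
      fun _ => x I := funext fun θ => hx ⟨R θ, hR θ⟩ I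
  rw [hconst] at hsum
  have h0 := hsum.unique (hasDerivAt_const (0 : ℝ) (x I))
  simp only [Finset.sum_mul] at h0
  rw [Finset.sum_comm] at h0
  have hrow (t : Fin k) : ∑ J : Fin k → Fin n,
      (∏ s ∈ Finset.univ.erase t, ((R 0 (I s) (J s) : ℝ) : ℂ)) • (L (I t) (J t) : ℂ) * x J =
      ∑ c, (L (I t) c : ℂ) * x (Function.update I t c) := by
    symm
    refine Fintype.sum_of_injective (fun c => Function.update I t c)
      (Function.update_injective I t) _ _ (fun J hJ => ?_) (fun c => ?_)
    · have : ∃ s ∈ Finset.univ.erase t, I s ≠ J s := by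
        by_contra! h
        refine hJ ⟨J t, ?_⟩
        ext1 s
        rcases eq_or_ne s t with rfl | hs
        · simp
        · simpa [hs] using h s (by simp [hs])
      obtain ⟨s, hs, hne⟩ := this
      rw [Finset.prod_eq_zero hs (by rw [hR0, Matrix.one_apply_ne hne]; simp)]
      simp
    · rw [Finset.prod_eq_one fun s hs => ?_]
      · simp
      · rw [Function.update_of_ne (Finset.ne_of_mem_erase hs), hR0, Matrix.one_apply_eq]
        simp
  simp only [hrow] at h0
  rw [← sub_eq_zero, ← h0]
  simp only [polarize, ← Finset.sum_sub_distrib]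
  refine Finset.sum_congr rfl fun t _ => ?_
  have hL (i j) : ((L i j : ℝ) : ℂ) =
      (if i = a ∧ j = b then 1 else 0) - (if i = b ∧ j = a then 1 else 0) := by
    change (((Matrix.single a b 1 - Matrix.single b a 1 : Matrix _ _ ℝ) i j : ℝ) : ℂ) = _
    rw [Matrix.sub_apply, Matrix.single_apply, Matrix.single_apply, Complex.ofReal_sub]
    simp only [apply_ite Complex.ofReal, Complex.ofReal_one, Complex.ofReal_zero, eq_comm]
  simp only [hL, sub_mul, Finset.sum_sub_distrib]
  congr 1 <;> simp [ite_and]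

theorem IsOrthogonalInvariant.even_card_fiber {n k : ℕ} {x : (Fin k → Fin n) → ℂ}
    (hx : IsOrthogonalInvariant x) {I : Fin k → Fin n} (hI : x I ≠ 0) (a : Fin n) :
    Even (Finset.univ.filter fun t => I t = a).card := by
  let d : Fin n → ℝ := fun i => if i = a then -1 else 1
  have hD : Matrix.diagonal d ∈ Matrix.orthogonalGroup (Fin n) ℝ := by
    rw [Matrix.mem_orthogonalGroup_iff, Matrix.diagonal_transpose, Matrix.diagonal_mul_diagonal,
      ← Matrix.diagonal_one]
    congr 1
    ext i
    by_cases h : i = a <;> simp [d, h]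
  have h := hx ⟨_, hD⟩ I
  rw [Fintype.sum_eq_single I] at h
  · simp only [Matrix.diagonal_apply_eq, d] at h
    have h1 := mul_right_cancel₀ hI (h.trans (one_mul _).symm)
    by_contra ho
    rw [Nat.not_even_iff_odd] at ho
    have h2 : (∏ t, (((if I t = a then -1 else 1 : ℝ)) : ℂ)) = -1 := by
      rw [← Complex.ofReal_prod, Finset.prod_ite]
      simp [ho.neg_one_pow]
    rw [h2] at h1
    norm_num at h1
  · intro J hJ
    obtain ⟨t, ht⟩ := Function.ne_iff.1 hJ
    rw [Finset.prod_eq_zero (Finset.mem_univ t), zero_mul]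
    simp [Matrix.diagonal_apply_ne _ ht.symm]

theorem sum_polarize_mul {n k : ℕ} (a b : Fin n) (x y : (Fin k → Fin n) → ℂ) :
    ∑ I, polarize a b x I * y I = ∑ I, x I * polarize b a y I := by
  simp only [polarize, Finset.sum_mul, Finset.mul_sum]
  rw [Finset.sum_comm, Finset.sum_comm (s := Finset.univ (α := Fin k → Fin n))]
  refine Finset.sum_congr rfl fun t _ => ?_
  simp only [ite_mul, zero_mul, mul_ite, mul_zero, ← Finset.sum_filter]
  refine Finset.sum_nbij' (fun I => Function.update I t b) (fun I => Function.update I t a)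
    ?_ ?_ ?_ ?_ ?_ <;> simp +contextual [eq_comm]

theorem sum_polarize_polarize {n k : ℕ} {x : (Fin k → Fin n) → ℂ}
    (htr : ∀ s t : Fin k, s ≠ t → ∀ I : Fin k → Fin n,
      ∑ c, x (Function.update (Function.update I s c) t c) = 0) (I : Fin k → Fin n) :
    ∑ a, ∑ b, polarize b a (polarize b a x) I = k * x I := by
  let F (a b : Fin n) (s t : Fin k) : ℂ := if I s = b then
    (if Function.update I s a t = b then
      x (Function.update (Function.update I s a) t a) else 0) else 0
  have hF (a b : Fin n) : polarize b a (polarize b a x) I = ∑ s, ∑ t, F a b s t := by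
    simp only [polarize, F, Finset.sum_ite_irrel, Finset.sum_const_zero]
  have h (s t : Fin k) : ∑ a, ∑ b, F a b s t = if s = t then x I else 0 := by
    simp only [F, Finset.sum_ite_eq, Finset.mem_univ, if_true]
    rcases eq_or_ne s t with rfl | hst
    · simp
    · simp only [Function.update_of_ne hst.symm, Finset.sum_ite_irrel, htr s t hst,
        Finset.sum_const_zero, ite_self, if_neg hst]
  calc _ = ∑ p : Fin n × Fin n, ∑ q : Fin k × Fin k, F p.1 p.2 q.1 q.2 := by
        simp only [hF, Fintype.sum_prod_type]
    _ = ∑ q : Fin k × Fin k, ∑ p : Fin n × Fin n, F p.1 p.2 q.1 q.2 := Finset.sum_comm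
    _ = _ := by simp [Fintype.sum_prod_type, h]

theorem IsOrthogonalInvariant.eq_zero_of_traceless {n k : ℕ} (hk : k ≠ 0)
    {x : (Fin k → Fin n) → ℂ} (hx : IsOrthogonalInvariant x)
    (htr : ∀ s t : Fin k, s ≠ t → ∀ I : Fin k → Fin n,
      ∑ c, x (Function.update (Function.update I s c) t c) = 0) : x = 0 := by
  have hconj (a b : Fin n) (I) : star (polarize a b x I) = polarize a b (star x) I := by
    simp [polarize, apply_ite (starRingEnd ℂ)]
  have hnorm : ∑ I, ∑ a, ∑ b, ‖polarize a b x I‖ ^ 2 = k * ∑ I, ‖x I‖ ^ 2 := by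
    have : ((∑ I, ∑ a, ∑ b, ‖polarize a b x I‖ ^ 2 : ℝ) : ℂ) = (k * ∑ I, ‖x I‖ ^ 2 : ℝ) := by
      push_cast
      simp only [← Complex.conj_mul', Finset.mul_sum, mul_left_comm (k : ℂ)]
      simp only [← sum_polarize_polarize htr, Finset.mul_sum]
      rw [Finset.sum_comm]
      conv_rhs => rw [Finset.sum_comm]
      refine Finset.sum_congr rfl fun a _ => ?_
      rw [Finset.sum_comm]
      conv_rhs => rw [Finset.sum_comm]
      refine Finset.sum_congr rfl fun b _ => ?_
      have h := sum_polarize_mul a b (star x) (polarize a b x)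
      simp only [← hconj] at h
      refine h.trans ?_
      rw [hx.polarize_comm a b]
      rfl
    exact_mod_cast this
  have hdiag (a : Fin n) (I) :
      polarize a a x I = (Finset.univ.filter fun t => I t = a).card * x I := by
    rw [polarize, ← Finset.sum_filter, ← nsmul_eq_mul, ← Finset.sum_const]
    refine Finset.sum_congr rfl fun t ht => ?_
    rw [Function.update_eq_self_iff.2 (Finset.mem_filter.1 ht).2.symm]
  have hle (I) : 2 * k * ‖x I‖ ^ 2 ≤ ∑ a, ∑ b, ‖polarize a b x I‖ ^ 2 := by
    rcases eq_or_ne (x I) 0 with h0 | h0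
    · rw [h0]; simp; positivity
    have hcard : (k : ℝ) = ∑ a, ((Finset.univ.filter fun t => I t = a).card : ℝ) := by
      have := Finset.card_eq_sum_card_fiberwise (f := I) (s := Finset.univ) (t := Finset.univ)
        (fun _ _ => Finset.mem_coe.2 (Finset.mem_univ _))
      rw [Finset.card_univ, Fintype.card_fin] at this
      exact_mod_cast this
    rw [hcard, Finset.mul_sum, Finset.sum_mul]
    refine Finset.sum_le_sum fun a _ => ?_
    refine le_trans ?_ (Finset.single_le_sum (f := fun b => ‖polarize a b x I‖ ^ 2)
      (fun b _ => by positivity) (Finset.mem_univ a))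
    rw [hdiag, norm_mul, mul_pow, Complex.norm_natCast]
    refine mul_le_mul_of_nonneg_right ?_ (by positivity)
    obtain ⟨m, hm⟩ := hx.even_card_fiber h0 a
    rw [hm]
    have : 2 * (m + m) ≤ (m + m) ^ 2 := by
      rcases Nat.eq_zero_or_pos m with rfl | h
      · simp
      · nlinarith
    exact_mod_cast this
  have htot := Finset.sum_le_sum fun I (_ : I ∈ Finset.univ) => hle I
  rw [hnorm, ← Finset.mul_sum] at htot
  have hkpos : (0 : ℝ) < k := by exact_mod_cast Nat.pos_of_ne_zero hk
  have hS : ∑ I, ‖x I‖ ^ 2 = 0 :=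
    le_antisymm (by nlinarith) (Finset.sum_nonneg fun _ _ => by positivity)
  rw [Finset.sum_eq_zero_iff_of_nonneg fun _ _ => by positivity] at hS
  funext I
  simpa using hS I (Finset.mem_univ I)

theorem IsOrthogonalInvariant.eq_zero_of_sum_EpairPartition {n : ℕ} :
    ∀ {k : ℕ} {x : (Fin k → Fin n) → ℂ}, IsOrthogonalInvariant x →
      (∀ π : Equiv.Perm (Fin k), (π * π = 1 ∧ ∀ t, π t ≠ t) →
        ∑ I, EpairPartition n k π I * x I = 0) → x = 0
  | 0, x, _, horth => by
      funext I
      have h := horth 1 ⟨rfl, fun t => t.elim0⟩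
      rw [Fintype.sum_eq_single I fun J hJ => absurd (Subsingleton.elim J I) hJ] at h
      simpa [EpairPartition] using h
  | 1, x, hx, _ => hx.eq_zero_of_traceless one_ne_zero fun s t hst =>
      absurd (Subsingleton.elim s t) hst
  | m + 2, x, hx, horth => by
      refine hx.eq_zero_of_traceless (by omega) fun s t hst I => ?_
      obtain ⟨σ, hσ₀, hσ₁⟩ : ∃ σ : Equiv.Perm (Fin (m + 2)), σ s = 0 ∧ σ t = 1 := by
        refine ⟨(Equiv.swap s 0).trans (Equiv.swap (Equiv.swap s 0 t) 1), ?_, ?_⟩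
        · have h : Equiv.swap s 0 t ≠ 0 := fun h => hst
            ((Equiv.swap s 0).injective (h.trans (Equiv.swap_apply_left s 0).symm)).symm
          simp [Equiv.swap_apply_of_ne_of_ne h.symm]
        · simp
      have hzero : contractFirst (fun J => x (J ∘ σ)) = 0 := by
        refine (isOrthogonalInvariant_contractFirst
          (hx.comp_perm σ)).eq_zero_of_sum_EpairPartition fun π hπ => ?_
        have hinv (u) : π (π u) = u := DFunLike.congr_fun hπ.1 u
        let f : Fin (m + 2) → Fin (m + 2) := Fin.cons 1 (Fin.cons 0 fun u => (π u).succ.succ)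
        have f0 : f 0 = 1 := rfl
        have f1 : f 1 = 0 := rfl
        have fs (u) : f (Fin.succ (Fin.succ u)) = (π u).succ.succ := rfl
        have hcases {p : Fin (m + 2) → Prop} (h0 : p 0) (h1 : p 1)
            (hs : ∀ u : Fin m, p u.succ.succ) (v) : p v :=
          Fin.cases h0 (Fin.cases h1 hs) v
        have hf : Function.Involutive f :=
          hcases (by rw [f0, f1]) (by rw [f1, f0]) (fun u => by rw [fs, fs, hinv])
        let τ : Equiv.Perm (Fin (m + 2)) := hf.toPerm
        have hτ (v) : τ v = f v := rfl
        have hτfix : ∀ v, τ v ≠ v := hcases (by rw [hτ, f0]; simp) (by rw [hτ, f1]; simp)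
          (fun u => by rw [hτ, fs]; simpa using hπ.2 u)
        have hτE (c d) (J : Fin m → Fin n) :
            EpairPartition n (m + 2) τ (Fin.cons c (Fin.cons d J)) =
              if c = d then EpairPartition n m π J else 0 := by
          unfold EpairPartition
          rw [← ite_and]
          congr 1
          rw [eq_iff_iff]
          constructor
          · intro h
            exact ⟨h 0, fun u => h u.succ.succ⟩
          · rintro ⟨rfl, h⟩
            exact hcases rfl rfl h
        have h := horth (σ⁻¹ * τ * σ) ⟨by
            ext u
            simp [hτ, hf _], fun u h => hτfix (σ u) (by
              simpa [Equiv.symm_apply_eq] using h)⟩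
        rw [← (σ.symm.arrowCongr (Equiv.refl (Fin n))).sum_comp] at h
        have hE (J : Fin (m + 2) → Fin n) :
            EpairPartition n (m + 2) (σ⁻¹ * τ * σ) (σ.symm.arrowCongr (Equiv.refl (Fin n)) J) =
              EpairPartition n (m + 2) τ J := by
          unfold EpairPartition
          congr 1
          rw [eq_iff_iff]
          refine ⟨fun h v => ?_, fun h v => ?_⟩
          · simpa using h (σ.symm v)
          · simpa using h (σ v)
        simp only [hE, sum_fin_cons, hτE, ite_mul, zero_mul, Finset.sum_ite_irrel,
          Finset.sum_const_zero, Finset.sum_ite_eq, Finset.mem_univ, if_true] at h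
        rw [Finset.sum_comm] at h
        simp only [contractFirst, Finset.mul_sum]
        exact h
      have hI := congrFun hzero fun u => I (σ.symm u.succ.succ)
      simp only [contractFirst, Pi.zero_apply] at hI
      rw [← hI]
      refine Finset.sum_congr rfl fun c _ => congrArg x ?_
      funext v
      obtain ⟨w, rfl⟩ := σ.symm.surjective v
      simp only [Function.comp_apply, Equiv.apply_symm_apply, Function.update_apply,
        Equiv.symm_apply_eq, hσ₀, hσ₁]
      refine Fin.cases (by simp) (fun w' => Fin.cases (by simp) (fun w'' => ?_) w') w
      have h1 : Fin.succ (Fin.succ w'') ≠ 1 := by simp [Fin.ext_iff]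
      simp [h1, Fin.succ_ne_zero]

/-- Invariant vectors for the orthogonal group (first fundamental theorem / Schur–Weyl
duality for `O(n)`): a vector of `(ℂ^n)^{⊗k}` is invariant under `O^{⊗k}` for every real
orthogonal `O` iff it lies in the span of the vectors `E_π` over pair partitions `π`
(fixed-point-free involutions of `{1,…,k}`).  In particular for odd `k` only `x = 0`
is invariant. -/
theorem stmt3 (n k : ℕ) (hn : 1 ≤ n) (hk : 1 ≤ k) :
    (∀ x : (Fin k → Fin n) → ℂ,
      (∀ O : Matrix.orthogonalGroup (Fin n) ℝ, ∀ I : Fin k → Fin n,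
          ∑ J : Fin k → Fin n,
            (∏ t : Fin k, (((O : Matrix (Fin n) (Fin n) ℝ) (I t) (J t) : ℝ) : ℂ)) * x J
            = x I) ↔
        x ∈ Submodule.span ℂ
          {v | ∃ π : Equiv.Perm (Fin k),
            (π * π = 1 ∧ ∀ t : Fin k, π t ≠ t) ∧ v = EpairPartition n k π}) ∧
    (Odd k → ∀ x : (Fin k → Fin n) → ℂ,
      (∀ O : Matrix.orthogonalGroup (Fin n) ℝ, ∀ I : Fin k → Fin n,
          ∑ J : Fin k → Fin n,
            (∏ t : Fin k, (((O : Matrix (Fin n) (Fin n) ℝ) (I t) (J t) : ℝ) : ℂ)) * x J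
            = x I) → x = 0) := by
  let W : Submodule ℂ ((Fin k → Fin n) → ℂ) := Submodule.span ℂ
    {v | ∃ π : Equiv.Perm (Fin k),
      (π * π = 1 ∧ ∀ t : Fin k, π t ≠ t) ∧ v = EpairPartition n k π}
  have hW {x} (hx : x ∈ W) : IsOrthogonalInvariant x := by
    induction hx using Submodule.span_induction with
    | mem x h =>
      obtain ⟨π, ⟨h₁, h₂⟩, rfl⟩ := h
      exact isOrthogonalInvariant_EpairPartition h₁ h₂
    | zero => intro O I; simp
    | add x y _ _ hx hy => exact hx.add hy
    | smul c x _ hx => exact hx.smul c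
  refine ⟨fun x => ⟨fun hx => ?_, hW⟩, fun hodd x hx => ?_⟩
  · let φ := WithLp.linearEquiv 2 ℂ ((Fin k → Fin n) → ℂ)
    let K : Submodule ℂ (EuclideanSpace ℂ (Fin k → Fin n)) := W.comap φ.toLinearMap
    obtain ⟨y, hy, z, hz, hyz⟩ := K.exists_add_mem_mem_orthogonal (φ.symm x)
    have hxyz : x = φ y + φ z := by rw [← map_add, ← hyz, φ.apply_symm_apply]
    have hφz : φ z = x + (-1 : ℂ) • φ y := by rw [hxyz]; simp
    have hzinv : IsOrthogonalInvariant (φ z) := by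
      rw [hφz]
      exact IsOrthogonalInvariant.add hx ((hW hy).smul _)
    have hz0 : φ z = 0 := hzinv.eq_zero_of_sum_EpairPartition fun π hπ => by
      have hmem : φ.symm (EpairPartition n k π) ∈ K := by
        change φ (φ.symm _) ∈ W
        rw [φ.apply_symm_apply]
        exact Submodule.subset_span ⟨π, hπ, rfl⟩
      have h := hz _ hmem
      rw [PiLp.inner_apply] at h
      rw [← h]
      refine Finset.sum_congr rfl fun I _ => ?_
      have hreal : star (EpairPartition n k π I) = EpairPartition n k π I := by
        unfold EpairPartition
        split_ifs <;> simp
      rw [← hreal, mul_comm]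
      rfl
    rw [hxyz, hz0, add_zero]
    exact hy
  · funext I
    by_contra hI
    have hcard := Finset.card_eq_sum_card_fiberwise (f := I) (s := Finset.univ)
      (t := Finset.univ) (fun _ _ => Finset.mem_coe.2 (Finset.mem_univ _))
    rw [Finset.card_univ, Fintype.card_fin] at hcard
    have heven : Even k := by
      rw [hcard]
      exact Finset.even_sum _ fun a _ => IsOrthogonalInvariant.even_card_fiber hx hI a
    exact Nat.not_even_iff_odd.2 hodd heven
end

section
/- Fix integers n, k ≥ 1 and let G_k(n) be the real symmetric matrix indexed by pairs of permutations σ, τ in the symmetric group S_k with entries G_k(n)_{σ,τ} = n^{#(στ⁻¹)}, where #ρ denotes the number of cycles of ρ counting fixed points. Then G_k(n) is positive semidefinite for every n ≥ 1, and G_k(n) is positive definite (in particular invertible) if and only if n ≥ k. -/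
/-- `cycleCount ρ`: the number of cycles of the permutation `ρ`, counting fixed points. -/
def cycleCount {k : ℕ} (ρ : Equiv.Perm (Fin k)) : ℕ :=
  ρ.cycleType.card + (Finset.univ.filter fun a : Fin k => ρ a = a).card

/-- The Gram matrix `G_k(n)` of the unitary Weingarten calculus, indexed by `S_k`,
with entries `n^{#(στ⁻¹)}`. -/
noncomputable def gramMatrix (k n : ℕ) :
    Matrix (Equiv.Perm (Fin k)) (Equiv.Perm (Fin k)) ℝ :=
  fun σ τ => (n : ℝ) ^ cycleCount (σ * τ⁻¹)

namespace Equiv.Perm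

/-- The orbits of a permutation are its nontrivial cycles together with its fixed points. -/
theorem natCard_quotient_sameCycle {α : Type*} [Fintype α] [DecidableEq α] (ρ : Perm α) :
    Nat.card (Quotient (SameCycle.setoid ρ)) =
      ρ.cycleType.card + (Finset.univ.filter fun a => ρ a = a).card := by
  classical
  have hne (c : ρ.cycleFactorsFinset) : ∃ x, x ∈ c.1.support :=
    (mem_cycleFactorsFinset_iff.1 c.2).1.nonempty_support
  choose p hp using hne
  have hc (c : ρ.cycleFactorsFinset) : c.1 = ρ.cycleOf (p c) := cycle_is_cycleOf (hp c) c.2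
  have hmoved (c : ρ.cycleFactorsFinset) : ρ (p c) ≠ p c :=
    mem_support.1 (mem_cycleFactorsFinset_support_le c.2 (hp c))
  let F : ρ.cycleFactorsFinset ⊕ {a // ρ a = a} → Quotient (SameCycle.setoid ρ) :=
    Sum.elim (fun c => Quotient.mk _ (p c)) (fun a => Quotient.mk _ a.1)
  have hF : Function.Bijective F := by
    constructor
    · rintro (c | a) (d | b) h
      · have h' : SameCycle ρ (p c) (p d) := Quotient.exact h
        have : c = d := Subtype.ext (by rw [hc c, hc d, h'.cycleOf_eq])
        rw [this]
      · have h' : SameCycle ρ (p c) b := Quotient.exact h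
        exact absurd (h'.apply_eq_self_iff.2 b.2) (hmoved c)
      · have h' : SameCycle ρ a (p d) := Quotient.exact h
        exact absurd (h'.apply_eq_self_iff.1 a.2) (hmoved d)
      · have h' : SameCycle ρ a b := Quotient.exact h
        have : a = b := Subtype.ext (h'.eq_of_left a.2)
        rw [this]
    · intro q
      induction q using Quotient.inductionOn with | h x => ?_
      by_cases hx : ρ x = x
      · exact ⟨Sum.inr ⟨x, hx⟩, rfl⟩
      · have hmem : ρ.cycleOf x ∈ ρ.cycleFactorsFinset :=
          cycleOf_mem_cycleFactorsFinset_iff.2 (mem_support.2 hx)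
        refine ⟨Sum.inl ⟨_, hmem⟩, Quotient.sound ?_⟩
        have := hp ⟨_, hmem⟩
        exact (mem_support_cycleOf_iff.1 this).1.symm
  rw [← Nat.card_congr (Equiv.ofBijective F hF), Nat.card_sum, cycleType_def]
  simp [Fintype.card_subtype]

/-- Functions constant along the orbits of `ρ` are functions on the set of orbits. -/
def fixedFunctionsEquiv {α : Type*} (β : Type*) (ρ : Perm α) :
    {f : α → β // ∀ x, f (ρ x) = f x} ≃ (Quotient (SameCycle.setoid ρ) → β) where
  toFun f := Quotient.lift f.1 (by
    rintro x _ ⟨i, rfl⟩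
    induction i using Int.induction_on with
    | zero => rfl
    | succ i ih => rw [add_comm, zpow_add, zpow_one, mul_apply, f.2, ih]
    | pred i ih =>
      rw [ih, ← f.2 ((ρ ^ (-(i : ℤ) - 1)) x), ← mul_apply, ← zpow_one_add, add_sub_cancel])
  invFun g := ⟨fun x => g (Quotient.mk _ x), fun x =>
    congrArg g (Quotient.sound (sameCycle_apply_left.2 (SameCycle.refl ρ x)))⟩
  left_inv f := rfl
  right_inv g := by
    ext q
    induction q using Quotient.inductionOn with | h x => rfl

end Equiv.Perm

open Equiv.Perm in
theorem natCard_fixed_functions {k : ℕ} (n : ℕ) (ρ : Equiv.Perm (Fin k)) :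
    Nat.card {f : Fin k → Fin n // ∀ x, f (ρ x) = f x} = n ^ cycleCount ρ := by
  rw [Nat.card_congr (fixedFunctionsEquiv _ ρ), Nat.card_fun, natCard_quotient_sameCycle,
    Nat.card_fin, cycleCount]

/-- The matrix whose row `σ` is the tensor of the action of `σ` on `(ℝⁿ)^{⊗k}`. -/
def permTensorMatrix (k n : ℕ) :
    Matrix (Equiv.Perm (Fin k)) ((Fin k → Fin n) × (Fin k → Fin n)) ℝ :=
  fun σ p => if p.1 ∘ σ = p.2 then 1 else 0

open scoped Matrix

theorem gramMatrix_eq_mul_conjTranspose (k n : ℕ) :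
    gramMatrix k n = permTensorMatrix k n * (permTensorMatrix k n)ᴴ := by
  ext σ τ
  have key : ∀ f : Fin k → Fin n, (∀ x, f ((σ * τ⁻¹) x) = f x) ↔ f ∘ σ = f ∘ τ := by
    intro f
    rw [funext_iff, ← τ.forall_congr_right (q := fun x => f ((σ * τ⁻¹) x) = f x)]
    simp
  rw [gramMatrix, ← Nat.cast_pow, ← natCard_fixed_functions, Nat.card_eq_fintype_card,
    Fintype.card_subtype]
  simp_rw [key]
  simp [Matrix.mul_apply, permTensorMatrix, Fintype.sum_prod_type, eq_comm]

theorem vecMul_permTensorMatrix_injective {k n : ℕ} (h : k ≤ n) :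
    Function.Injective (permTensorMatrix k n).vecMul := by
  intro x y hxy
  ext τ
  have inj := Fin.castLE_injective h
  have hτ := congrFun hxy (Fin.castLE h, Fin.castLE h ∘ τ)
  simpa [Matrix.vecMul, dotProduct, permTensorMatrix, inj.comp_left.eq_iff] using hτ

theorem sign_vecMul_permTensorMatrix {k n : ℕ} (h : n < k) :
    (fun σ : Equiv.Perm (Fin k) => ((Equiv.Perm.sign σ : ℤ) : ℝ)) ᵥ* permTensorMatrix k n = 0 := by
  ext ⟨f, g⟩
  obtain ⟨i, j, hij, hf⟩ := Fintype.exists_ne_map_eq_of_card_lt f (by simpa using h)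
  have hswap : f ∘ Equiv.swap i j = f := by
    ext x
    simp only [Function.comp_apply, Equiv.swap_apply_def]
    split_ifs <;> simp_all
  simp only [Matrix.vecMul, dotProduct, permTensorMatrix, Pi.zero_apply]
  refine Finset.sum_involution (fun σ _ => Equiv.swap i j * σ) ?_ ?_ ?_ ?_
  · intro σ _
    have : f ∘ ⇑(Equiv.swap i j * σ) = f ∘ σ := by
      rw [Equiv.Perm.coe_mul, ← Function.comp_assoc, hswap]
    rw [this, Equiv.Perm.sign_mul, Equiv.Perm.sign_swap hij]
    split_ifs <;> simp
  · intro σ _ _ he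
    exact hij (Equiv.swap_eq_one_iff.1 (mul_eq_right.1 he))
  · simp
  · simp

/-- `G_k(n)` is positive semidefinite for every `n ≥ 1`, and positive definite
(in particular invertible) if and only if `n ≥ k`. -/
theorem stmt6 (k n : ℕ) (hk : 1 ≤ k) (hn : 1 ≤ n) :
    (gramMatrix k n).PosSemidef ∧ ((gramMatrix k n).PosDef ↔ k ≤ n) := by
  rw [gramMatrix_eq_mul_conjTranspose]
  refine ⟨Matrix.posSemidef_self_mul_conjTranspose _, fun hpos => ?_, fun h =>
    Matrix.PosDef.mul_conjTranspose_self _ (vecMul_permTensorMatrix_injective h)⟩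
  by_contra! hlt
  have hinj := Matrix.vecMul_injective_of_isUnit hpos.isUnit
  have h0 := @hinj (fun σ => ((Equiv.Perm.sign σ : ℤ) : ℝ)) 0 (by
    simp only [← Matrix.vecMul_vecMul, sign_vecMul_permTensorMatrix hlt, Matrix.zero_vecMul])
  simpa using congrFun h0 1
end

section
/- Fix an integer k ≥ 1 and work in the group algebra of the symmetric group S_k over the polynomial ring ℤ[x]. For 1 ≤ i ≤ k, let J_i = Σ_{j < i} λ_{(j i)} be the i-th Jucys–Murphy element (sum over transpositions (j i) with j < i; in particular J_1 = 0). Then the following identity holds: ∏_{i=1}^{k} (x·λ_e + J_i) = Σ_{σ ∈ S_k} x^{#σ} λ_σ, where #σ denotes the number of cycles of σ counting fixed points, λ_σ denotes the group algebra basis element corresponding to σ, and the product is taken in the order i = 1, 2, …, k. -/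
open Equiv Equiv.Perm

/-- Inserting a fixed point into a nontrivial cycle keeps the number of nontrivial cycles. -/
theorem card_cycleType_mul_swap_of_ne {α : Type*} [Fintype α] [DecidableEq α] {σ : Perm α}
    {j m : α} (hm : σ m = m) (hj : σ j ≠ j) :
    (σ * swap j m).cycleType.card = σ.cycleType.card := by
  have hjm : j ≠ m := by rintro rfl; exact hj hm
  have hmem : σ.cycleOf j ∈ σ.cycleFactorsFinset :=
    cycleOf_mem_cycleFactorsFinset_iff.2 (mem_support.2 hj)
  have hcyc : (σ.cycleOf j).IsCycle := isCycle_cycleOf σ hj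
  set c := σ.cycleOf j with hc
  have hdisj : (σ * c⁻¹).Disjoint c := disjoint_mul_inv_of_mem_cycleFactorsFinset hmem
  have hcm : c m = m := by
    by_contra h
    exact mem_support.1 (support_cycleOf_le σ j (mem_support.2 h)) hm
  have hcj : c j ≠ j := by rwa [hc, cycleOf_apply_self]
  have hlist : swap m j * c = (m :: σ.toList j).formPerm := by
    have hne : σ.toList j = j :: (σ.toList j).tail := by
      have h0 : σ.toList j ≠ [] := by
        rw [Ne, toList_eq_nil_iff, not_not]; exact mem_support.2 hj
      obtain ⟨a, l, hl⟩ := List.exists_cons_of_ne_nil h0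
      have := getElem_toList (p := σ) (x := j) (n := 0) (by simp [hl])
      simp [hl] at this
      simp [hl, this]
    have hf := formPerm_toList σ j
    rw [hne] at hf ⊢
    rw [List.formPerm_cons_cons, hf]
  have hcyc' : (swap m j * c).IsCycle := by
    rw [hlist]
    refine List.isCycle_formPerm ?_ ?_
    · rw [List.nodup_cons]
      refine ⟨fun h => ?_, nodup_toList σ j⟩
      have := (mem_toList_iff.1 h).1
      exact hjm ((this.eq_of_right hm))
    · have := two_le_length_toList_iff_mem_support.2 (mem_support.2 hj)
      simp only [List.length_cons]; omega
  have hdisj' : (swap m j * c).Disjoint (c⁻¹ * σ) := by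
    have hcomm : c⁻¹ * σ = σ * c⁻¹ := by
      have := (self_mem_cycle_factors_commute hmem).inv_left
      exact this.eq
    rw [hcomm]
    intro x
    rcases hdisj x with h | h
    · exact Or.inr h
    · by_cases hxm : x = m
      · right
        rw [hxm, Perm.mul_apply, (Perm.inv_eq_iff_eq (f := c)).2 hcm.symm, hm]
      · by_cases hxj : x = j
        · exact absurd (hxj ▸ h) hcj
        · left
          rw [Perm.mul_apply, h, swap_apply_of_ne_of_ne hxm hxj]
  have hconj : (σ * swap j m).cycleType = (swap m j * σ).cycleType := by
    rw [← cycleType_conj (σ := σ * swap j m) (τ := swap m j)]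
    congr 1
    rw [swap_inv, swap_comm j m, mul_assoc, mul_assoc, swap_mul_self, mul_one]
  have h1 : swap m j * σ = (swap m j * c) * (c⁻¹ * σ) := by group
  have h2 : σ.cycleType = c.cycleType + (σ * c⁻¹).cycleType := by
    rw [← hdisj.symm.cycleType_mul, ← hdisj.commute.eq]; group
  have h3 : (c⁻¹ * σ) = σ * c⁻¹ := (self_mem_cycle_factors_commute hmem).inv_left.eq
  rw [hconj, h1, hdisj'.cycleType_mul, h2, hcyc.cycleType, hcyc'.cycleType, h3]
  simp

/-- Joining two fixed points creates one new nontrivial cycle. -/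
theorem card_cycleType_mul_swap_of_eq {α : Type*} [Fintype α] [DecidableEq α] {σ : Perm α}
    {j m : α} (hm : σ m = m) (hj : σ j = j) (hjm : j ≠ m) :
    (σ * swap j m).cycleType.card = σ.cycleType.card + 1 := by
  have hd : σ.Disjoint (swap j m) := by
    intro x
    by_cases hxm : x = m
    · left; rw [hxm, hm]
    · by_cases hxj : x = j
      · left; rw [hxj, hj]
      · right; exact swap_apply_of_ne_of_ne hxj hxm
  rw [hd.cycleType_mul, (isCycle_swap hjm).cycleType]
  simp

/-- The number of cycles of `σ`, counting only the fixed points below `m`. -/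
def cycleCountBelow {k : ℕ} (m : ℕ) (σ : Perm (Fin k)) : ℕ :=
  σ.cycleType.card + (Finset.univ.filter fun a : Fin k => (a : ℕ) < m ∧ σ a = a).card

/-- The permutations of `Fin k` that fix every `a ≥ m`. -/
def permsBelow (k m : ℕ) : Finset (Perm (Fin k)) :=
  Finset.univ.filter fun σ => ∀ a : Fin k, m ≤ (a : ℕ) → σ a = a

theorem mem_permsBelow {k m : ℕ} {σ : Perm (Fin k)} :
    σ ∈ permsBelow k m ↔ ∀ a : Fin k, m ≤ (a : ℕ) → σ a = a := by
  simp [permsBelow]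

theorem cycleCountBelow_succ_of_apply_eq {k : ℕ} {σ : Perm (Fin k)} {m : Fin k} (hm : σ m = m) :
    cycleCountBelow (m + 1) σ = cycleCountBelow m σ + 1 := by
  have : (Finset.univ.filter fun a : Fin k => (a : ℕ) < m + 1 ∧ σ a = a) =
      insert m (Finset.univ.filter fun a : Fin k => (a : ℕ) < m ∧ σ a = a) := by
    ext a
    simp only [Finset.mem_filter, Finset.mem_univ, true_and, Finset.mem_insert, Fin.ext_iff]
    constructor
    · rintro ⟨h, h'⟩
      by_cases hh : (a : ℕ) = m
      · exact Or.inl hh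
      · exact Or.inr ⟨by omega, h'⟩
    · rintro (h | h)
      · obtain rfl := Fin.ext h
        exact ⟨by omega, by rw [hm]⟩
      · exact ⟨by omega, h.2⟩
  rw [cycleCountBelow, cycleCountBelow, this, Finset.card_insert_of_notMem (by simp), add_assoc]

theorem mul_swap_apply_eq_iff {α : Type*} [DecidableEq α] {σ : Perm α} {j m : α} (hm : σ m = m)
    (hjm : j ≠ m) (a : α) : (σ * swap j m) a = a ↔ a ≠ j ∧ a ≠ m ∧ σ a = a := by
  rw [Perm.mul_apply]
  by_cases haj : a = j
  · subst haj
    simp [hm, hjm.symm]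
  · by_cases ham : a = m
    · subst ham
      have : σ j ≠ a := fun h => hjm (σ.injective (h.trans hm.symm))
      simp [this]
    · simp [swap_apply_of_ne_of_ne haj ham, haj, ham]

theorem cycleCountBelow_succ_mul_swap {k : ℕ} {σ : Perm (Fin k)} {j m : Fin k} (hm : σ m = m)
    (hjm : j < m) : cycleCountBelow (m + 1) (σ * swap j m) = cycleCountBelow m σ := by
  have hset : (Finset.univ.filter fun a : Fin k => (a : ℕ) < m + 1 ∧ (σ * swap j m) a = a) =
      (Finset.univ.filter fun a : Fin k => (a : ℕ) < m ∧ σ a = a).erase j := by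
    ext a
    simp only [Finset.mem_filter, Finset.mem_univ, true_and, Finset.mem_erase,
      mul_swap_apply_eq_iff hm hjm.ne]
    constructor
    · rintro ⟨h, h1, h2, h3⟩
      have := Fin.val_ne_of_ne h2
      exact ⟨h1, by omega, h3⟩
    · rintro ⟨h1, h2, h3⟩
      exact ⟨by omega, h1, (Fin.lt_def.2 h2).ne, h3⟩
  rw [cycleCountBelow, cycleCountBelow, hset]
  by_cases hj : σ j = j
  · have hmem : j ∈ Finset.univ.filter fun a : Fin k => (a : ℕ) < m ∧ σ a = a := by
      simpa [hj] using hjm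
    rw [card_cycleType_mul_swap_of_eq hm hj hjm.ne, ← Finset.card_erase_add_one hmem]
    omega
  · rw [card_cycleType_mul_swap_of_ne hm hj, Finset.erase_eq_of_notMem (by simp [hj])]

open Polynomial in
theorem sum_permsBelow_mul {k : ℕ} (m : Fin k) :
    (∑ σ ∈ permsBelow k m, MonoidAlgebra.single σ ((X : ℤ[X]) ^ cycleCountBelow m σ)) *
      (MonoidAlgebra.single (1 : Perm (Fin k)) (X : ℤ[X]) +
        ∑ j ∈ Finset.univ.filter fun j : Fin k => j < m,
          MonoidAlgebra.single (swap j m) (1 : ℤ[X])) =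
      ∑ σ ∈ permsBelow k (m + 1),
        MonoidAlgebra.single σ ((X : ℤ[X]) ^ cycleCountBelow (m + 1) σ) := by
  have hfac : MonoidAlgebra.single (1 : Perm (Fin k)) (X : ℤ[X]) +
      ∑ j ∈ Finset.univ.filter (fun j : Fin k => j < m),
        MonoidAlgebra.single (swap j m) (1 : ℤ[X]) =
      ∑ j ∈ Finset.Iic m, MonoidAlgebra.single (swap j m) (if j = m then (X : ℤ[X]) else 1) := by
    have hI : Finset.Iic m = insert m (Finset.univ.filter fun j : Fin k => j < m) := by
      ext a
      simp [le_iff_eq_or_lt]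
    rw [hI, Finset.sum_insert (by simp), swap_self, if_pos rfl]
    congr 1
    refine Finset.sum_congr rfl fun j hj => ?_
    rw [if_neg (Finset.mem_filter.1 hj).2.ne]
  rw [hfac, Finset.sum_mul_sum, ← Finset.sum_product']
  refine Finset.sum_nbij' (fun p => p.1 * swap p.2 m)
    (fun τ => (τ * swap (τ⁻¹ m) m, τ⁻¹ m)) ?_ ?_ ?_ ?_ ?_
  · rintro ⟨σ, j⟩ h
    simp only [Finset.mem_product, mem_permsBelow, Finset.mem_Iic] at h ⊢
    intro a ha
    have hma : m < a := Fin.lt_def.2 ha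
    rw [Perm.mul_apply, swap_apply_of_ne_of_ne (h.2.trans_lt hma).ne' hma.ne']
    exact h.1 a (by omega)
  · intro τ h
    simp only [Finset.mem_product, mem_permsBelow, Finset.mem_Iic] at h ⊢
    have hle : τ⁻¹ m ≤ m := by
      by_contra! hlt
      have := h _ (Fin.lt_def.1 hlt)
      exact hlt.ne ((τ.apply_symm_apply m).symm.trans this)
    refine ⟨fun a ha => ?_, hle⟩
    rcases (Fin.le_def.2 ha).eq_or_lt with rfl | hlt
    · simp
    · rw [Perm.mul_apply, swap_apply_of_ne_of_ne (hle.trans_lt hlt).ne' hlt.ne']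
      exact h a (Fin.lt_def.1 hlt)
  · rintro ⟨σ, j⟩ h
    simp only [Finset.mem_product, mem_permsBelow] at h
    have hm : σ⁻¹ m = m := Perm.inv_eq_iff_eq.2 (h.1 m le_rfl).symm
    have hj : (σ * swap j m)⁻¹ m = j := by
      rw [mul_inv_rev, swap_inv, Perm.mul_apply, hm, swap_apply_right]
    simp only [hj, mul_assoc, swap_mul_self, mul_one]
  · intro τ _
    simp only [mul_assoc, swap_mul_self, mul_one]
  · rintro ⟨σ, j⟩ h
    simp only [Finset.mem_product, mem_permsBelow, Finset.mem_Iic] at h ⊢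
    have hm := h.1 m le_rfl
    rw [MonoidAlgebra.single_mul_single]
    rcases h.2.eq_or_lt with rfl | hlt
    · rw [if_pos rfl, swap_self, ← Perm.one_def, mul_one, cycleCountBelow_succ_of_apply_eq hm,
        pow_succ]
    · rw [if_neg hlt.ne, mul_one, cycleCountBelow_succ_mul_swap hm hlt]

open Polynomial in
theorem prod_jucysMurphy_castLE {k : ℕ} (m : ℕ) (hmk : m ≤ k) :
    (List.ofFn fun i : Fin m =>
        (MonoidAlgebra.single (1 : Perm (Fin k)) (X : ℤ[X]) +
          ∑ j ∈ Finset.univ.filter fun j : Fin k => j < i.castLE hmk,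
            MonoidAlgebra.single (swap j (i.castLE hmk)) (1 : ℤ[X]))).prod =
      ∑ σ ∈ permsBelow k m, MonoidAlgebra.single σ ((X : ℤ[X]) ^ cycleCountBelow m σ) := by
  induction m with
  | zero =>
    have h : permsBelow k 0 = {1} := by
      ext σ
      simp [mem_permsBelow, Perm.ext_iff]
    simp [h, cycleCountBelow, MonoidAlgebra.one_def]
  | succ m ih =>
    rw [List.ofFn_succ', List.concat_eq_append, List.prod_append, List.prod_singleton]
    exact (congrArg (· * _) (ih (Nat.le_of_succ_le hmk))).trans (sum_permsBelow_mul ⟨m, hmk⟩)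


/-- The Jucys–Murphy identity in the group algebra `ℤ[x][S_k]`:
`∏_{i=1}^k (x·λ_e + J_i) = Σ_{σ ∈ S_k} x^{#σ} λ_σ`, where
`J_i = Σ_{j<i} λ_{(j i)}` is the `i`-th Jucys–Murphy element, the product being taken
in the order `i = 1, 2, …, k`. -/
theorem stmt7 (k : ℕ) (hk : 1 ≤ k) :
    (List.ofFn fun i : Fin k =>
        (MonoidAlgebra.single (1 : Equiv.Perm (Fin k)) (Polynomial.X : Polynomial ℤ) +
          ∑ j ∈ Finset.univ.filter fun j : Fin k => j < i,
            MonoidAlgebra.single (Equiv.swap j i) (1 : Polynomial ℤ))).prod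
      = ∑ σ : Equiv.Perm (Fin k),
          MonoidAlgebra.single σ ((Polynomial.X : Polynomial ℤ) ^ cycleCount σ) := by
  have h := prod_jucysMurphy_castLE k le_rfl
  have hperms : permsBelow k k = Finset.univ := by
    ext σ
    simp only [mem_permsBelow, Finset.mem_univ, iff_true]
    intro a ha
    omega
  have hcount (σ : Perm (Fin k)) : cycleCountBelow k σ = cycleCount σ := by
    simp [cycleCountBelow, cycleCount]
  simpa only [hperms, hcount, Fin.castLE_rfl, id] using h
end

section
/- Fix an integer k ≥ 1 and a permutation σ of {1,…,k}. For l ≥ 0, let P(σ,l) denote the finite set of l-tuples ((i_1,j_1),…,(i_l,j_l)) of pairs with i_p < j_p for every p and j_1 ≤ j_2 ≤ ⋯ ≤ j_l (weakly increasing), such that σ = (i_1 j_1)(i_2 j_2)⋯(i_l j_l), composition applying the rightmost transposition first. Then there exists an integer N such that for every integer n ≥ N, the series Σ_{l≥0} #P(σ,l) n^{-l} converges absolutely and the unitary Weingarten function satisfies Wg(n,σ) = n^{-k} Σ_{l ≥ 0} #P(σ,l) (−1)^l n^{-l}. -/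
/-- The unitary Weingarten function `Wg(n,σ) = (G_k(n)⁻¹)_{σ,e}`. -/
noncomputable def Wg (k n : ℕ) (σ : Equiv.Perm (Fin k)) : ℝ :=
  (gramMatrix k n)⁻¹ σ 1

/-- `#P(σ,l)`: the number of `l`-tuples `((i₁,j₁),…,(i_l,j_l))` with `i_p < j_p`,
`j₁ ≤ j₂ ≤ ⋯ ≤ j_l`, whose product of transpositions `(i₁ j₁)⋯(i_l j_l)` is `σ`
(the rightmost transposition applied first). -/
noncomputable def PsetCard (k : ℕ) (σ : Equiv.Perm (Fin k)) (l : ℕ) : ℕ :=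
  Nat.card {f : Fin l → Fin k × Fin k //
    (∀ p : Fin l, (f p).1 < (f p).2) ∧
    (∀ p q : Fin l, p ≤ q → (f p).2 ≤ (f q).2) ∧
    ((List.ofFn f).map fun p => Equiv.swap p.1 p.2).prod = σ}

open Equiv Equiv.Perm in
/-- Multiplying by a transposition joining a fixed point to another point merges two cycles. -/
theorem cycleCount_swap_mul {k : ℕ} {ρ : Equiv.Perm (Fin k)} {i m : Fin k} (him : i ≠ m)
    (hm : ρ m = m) : cycleCount (swap i m * ρ) + 1 = cycleCount ρ := by
  have hfix : ∀ a, (swap i m * ρ) a = a ↔ ρ a = a ∧ a ≠ m ∧ a ≠ i := by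
    intro a
    rw [mul_apply, swap_apply_eq_iff]
    by_cases ham : a = m
    · subst ham
      simp [hm, him.symm]
    by_cases hai : a = i
    · subst hai
      have : ρ a ≠ m := fun h => ham (ρ.injective (h.trans hm.symm))
      simpa using this
    · simp [swap_apply_of_ne_of_ne hai ham, ham, hai]
  unfold cycleCount
  by_cases hi : ρ i = i
  · have hd : Disjoint (swap i m) ρ := by
      intro a
      by_cases ham : a = m
      · exact Or.inr (ham ▸ hm)
      by_cases hai : a = i
      · exact Or.inr (hai ▸ hi)
      · exact Or.inl (swap_apply_of_ne_of_ne hai ham)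
    have hs : (Finset.univ.filter fun a => ρ a = a)
        = insert m (insert i (Finset.univ.filter fun a => (swap i m * ρ) a = a)) := by
      ext a
      simp only [Finset.mem_filter, Finset.mem_univ, true_and, Finset.mem_insert, hfix]
      grind
    rw [hs, Finset.card_insert_of_notMem, Finset.card_insert_of_notMem, hd.cycleType_mul,
      Multiset.card_add, card_cycleType_eq_one.2 (isCycle_swap him)]
    · ring
    · rw [Finset.mem_filter, hfix]
      tauto
    · rw [Finset.mem_insert, Finset.mem_filter, hfix]
      tauto
  · have hs : (Finset.univ.filter fun a => ρ a = a)
        = insert m (Finset.univ.filter fun a => (swap i m * ρ) a = a) := by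
      ext a
      simp only [Finset.mem_filter, Finset.mem_univ, true_and, Finset.mem_insert, hfix]
      grind
    rw [hs, Finset.card_insert_of_notMem (by rw [Finset.mem_filter, hfix]; tauto)]
    have hcyc : IsCycle (ρ.cycleOf i) := isCycle_cycleOf ρ hi
    have hmem : m ∉ toList ρ i := by
      rw [mem_toList_iff]
      rintro ⟨h, -⟩
      exact him (h.eq_of_right hm)
    have hg : IsCycle (swap i m * ρ.cycleOf i) := by
      obtain ⟨l, hl⟩ : ∃ l, toList ρ i = i :: l := by
        have h0 : 0 < (toList ρ i).length := by
          have := two_le_length_toList_iff_mem_support.2 (mem_support.2 hi)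
          omega
        have h1 := toList_getElem_zero ρ i (mem_support.2 hi)
        cases h : toList ρ i with
        | nil => simp [h] at h0
        | cons b l => simp only [h, List.getElem_cons_zero] at h1; exact ⟨l, by rw [h1]⟩
      have hc : swap i m * ρ.cycleOf i = List.formPerm (m :: toList ρ i) := by
        rw [← formPerm_toList, hl, List.formPerm_cons_cons, swap_comm]
      rw [hc]
      refine List.isCycle_formPerm (List.nodup_cons.2 ⟨hmem, nodup_toList ρ i⟩) ?_
      simp [hl]
    obtain ⟨d, hd⟩ : ∃ d, d = ρ * (ρ.cycleOf i)⁻¹ := ⟨_, rfl⟩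
    have hdis : Disjoint (ρ.cycleOf i) d := hd ▸ (disjoint_mul_inv_of_mem_cycleFactorsFinset
      (cycleOf_mem_cycleFactorsFinset_iff.2 (mem_support.2 hi))).symm
    have hρ : ρ = ρ.cycleOf i * d := by
      rw [hdis.commute.eq, hd, inv_mul_cancel_right]
    have hdm : d m = m := by
      have h1 : ρ.cycleOf i m = m := cycleOf_apply_of_not_sameCycle
        (fun h => him (h.eq_of_right hm))
      rw [hd, mul_apply, inv_eq_iff_eq.2 h1.symm, hm]
    have hdi : d i = i := (hdis i).resolve_left (by simpa using hi)
    have hdis' : Disjoint (swap i m * ρ.cycleOf i) d := by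
      refine Disjoint.mul_left (fun a => ?_) hdis
      by_cases ham : a = m
      · exact Or.inr (ham ▸ hdm)
      by_cases hai : a = i
      · exact Or.inr (hai ▸ hdi)
      · exact Or.inl (swap_apply_of_ne_of_ne hai ham)
    have h1 : (swap i m * ρ).cycleType.card = 1 + d.cycleType.card := by
      conv_lhs => rw [hρ, ← mul_assoc, hdis'.cycleType_mul, Multiset.card_add,
        card_cycleType_eq_one.2 hg]
    have h2 : ρ.cycleType.card = 1 + d.cycleType.card := by
      conv_lhs => rw [hρ, hdis.cycleType_mul, Multiset.card_add, card_cycleType_eq_one.2 hcyc]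
    rw [h1, h2]
    ring

/-- Number of factorizations of `σ` as in `PsetCard`, all of whose pairs have second entry below
`m`. -/
noncomputable def boundedPsetCard {k : ℕ} (m l : ℕ) (σ : Equiv.Perm (Fin k)) : ℕ :=
  Nat.card {f : Fin l → Fin k × Fin k //
    ((∀ p : Fin l, (f p).1 < (f p).2) ∧
    (∀ p q : Fin l, p ≤ q → (f p).2 ≤ (f q).2) ∧
    ((List.ofFn f).map fun p => Equiv.swap p.1 p.2).prod = σ) ∧
    ∀ p : Fin l, ((f p).2 : ℕ) < m}

theorem boundedPsetCard_self {k : ℕ} (l : ℕ) (σ : Equiv.Perm (Fin k)) :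
    boundedPsetCard k l σ = PsetCard k σ l := by
  simp only [boundedPsetCard, PsetCard, Fin.is_lt, implies_true, and_true]

theorem boundedPsetCard_zero {k : ℕ} (m : ℕ) (σ : Equiv.Perm (Fin k)) :
    boundedPsetCard m 0 σ = if σ = 1 then 1 else 0 := by
  unfold boundedPsetCard
  split_ifs with h
  · subst h
    rw [Nat.card_eq_one_iff_unique]
    exact ⟨inferInstance, ⟨⟨Fin.elim0, by simp⟩⟩⟩
  · rw [Nat.card_eq_zero]
    left
    refine ⟨fun f => h ?_⟩
    simpa using f.2.1.2.2.symm

theorem boundedPsetCard_zero_succ {k : ℕ} (l : ℕ) (σ : Equiv.Perm (Fin k)) :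
    boundedPsetCard 0 (l + 1) σ = 0 := by
  rw [boundedPsetCard, Nat.card_eq_zero]
  exact Or.inl ⟨fun f => absurd (f.2.2 0) (Nat.not_lt_zero _)⟩

theorem boundedPsetCard_le {k : ℕ} (m l : ℕ) (σ : Equiv.Perm (Fin k)) :
    boundedPsetCard m l σ ≤ (k * k) ^ l := by
  refine (Finite.card_subtype_le _).trans ?_
  simp [Nat.card_eq_fintype_card]

/-- Splitting off the last transposition of a monotone factorization. -/
theorem boundedPsetCard_succ_eq_sum {k : ℕ} (m l : ℕ) (σ : Equiv.Perm (Fin k)) :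
    boundedPsetCard m (l + 1) σ =
      ∑ p ∈ Finset.univ.filter (fun p : Fin k × Fin k => p.1 < p.2 ∧ (p.2 : ℕ) < m),
        boundedPsetCard (p.2 + 1) l (σ * Equiv.swap p.1 p.2) := by
  classical
  have hprod : ∀ f : Fin (l + 1) → Fin k × Fin k,
      ((List.ofFn f).map fun p => Equiv.swap p.1 p.2).prod =
      ((List.ofFn fun p : Fin l => f p.castSucc).map fun p => Equiv.swap p.1 p.2).prod *
        Equiv.swap (f (Fin.last l)).1 (f (Fin.last l)).2 := by
    intro f
    rw [List.ofFn_succ']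
    simp
  have key : boundedPsetCard m (l + 1) σ = Nat.card (Σ p : {p : Fin k × Fin k //
      p.1 < p.2 ∧ (p.2 : ℕ) < m}, {f : Fin l → Fin k × Fin k //
    ((∀ p : Fin l, (f p).1 < (f p).2) ∧
    (∀ p q : Fin l, p ≤ q → (f p).2 ≤ (f q).2) ∧
    ((List.ofFn f).map fun p => Equiv.swap p.1 p.2).prod = σ * Equiv.swap p.1.1 p.1.2) ∧
    ∀ q : Fin l, ((f q).2 : ℕ) < p.1.2 + 1}) := by
    refine Nat.card_congr
      { toFun := fun f => ⟨⟨f.1 (Fin.last l), f.2.1.1 _, f.2.2 _⟩, fun p => f.1 p.castSucc,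
          ⟨fun p => f.2.1.1 _, fun p q h => f.2.1.2.1 _ _ (Fin.castSucc_le_castSucc_iff.2 h), ?_⟩,
          fun q => Nat.lt_succ_of_le (f.2.1.2.1 _ _ (Fin.le_last _))⟩
        invFun := fun f => ⟨Fin.snoc f.2.1 f.1.1, ⟨?_, ?_, ?_⟩, ?_⟩
        left_inv := ?_
        right_inv := ?_ }
    · rw [← mul_inv_eq_iff_eq_mul, Equiv.swap_inv, ← hprod]
      exact f.2.1.2.2
    · intro p
      induction p using Fin.lastCases with
      | last => simpa using f.1.2.1
      | cast p => simpa using f.2.2.1.1 p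
    · intro p q
      induction p using Fin.lastCases with
      | last =>
        intro h
        rw [Fin.last_le_iff.1 h]
      | cast p =>
        induction q using Fin.lastCases with
        | last => intro _; simpa using Nat.le_of_lt_succ (f.2.2.2 p)
        | cast q => simpa using f.2.2.1.2.1 p q
    · rw [hprod]
      simp only [Fin.snoc_castSucc, Fin.snoc_last]
      rw [f.2.2.1.2.2, mul_assoc, Equiv.swap_mul_self, mul_one]
    · intro p
      induction p using Fin.lastCases with
      | last => simpa using f.1.2.2
      | cast p =>
        have h1 := f.2.2.2 p
        have h2 := f.1.2.2
        simp only [Fin.snoc_castSucc]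
        omega
    · rintro ⟨f, hf⟩
      apply Subtype.ext
      exact Fin.snoc_init_self f
    · rintro ⟨⟨p, hp⟩, f, hf⟩
      refine Sigma.subtype_ext (Subtype.ext ?_) ?_
      · simp
      · funext q
        simp
  rw [key, Nat.card_sigma]
  change ∑ p : {p : Fin k × Fin k // p.1 < p.2 ∧ (p.2 : ℕ) < m},
    boundedPsetCard (p.1.2 + 1) l (σ * Equiv.swap p.1.1 p.1.2) = _
  exact (Finset.sum_subtype _ (by simp)
    fun p : Fin k × Fin k => boundedPsetCard (p.2 + 1) l (σ * Equiv.swap p.1 p.2)).symm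

/-- Two-variable recursion: the last transposition either avoids the level `m` or sits on it. -/
theorem boundedPsetCard_succ_succ {k : ℕ} (m : Fin k) (l : ℕ) (σ : Equiv.Perm (Fin k)) :
    boundedPsetCard (m + 1) (l + 1) σ = boundedPsetCard m (l + 1) σ +
      ∑ i ∈ Finset.univ.filter (· < m), boundedPsetCard (m + 1) l (σ * Equiv.swap i m) := by
  rw [boundedPsetCard_succ_eq_sum, boundedPsetCard_succ_eq_sum, Finset.sum_filter]
  rw [Finset.sum_filter, Finset.sum_filter, Fintype.sum_prod_type, Fintype.sum_prod_type,
    ← Finset.sum_add_distrib]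
  refine Finset.sum_congr rfl fun i _ => ?_
  have hm : (if i < m then boundedPsetCard (m + 1) l (σ * Equiv.swap i m) else 0) =
      ∑ j : Fin k, if j = m then
        (if i < j then boundedPsetCard (j + 1) l (σ * Equiv.swap i j) else 0) else 0 := by
    simp
  rw [hm, ← Finset.sum_add_distrib]
  refine Finset.sum_congr rfl fun j _ => ?_
  by_cases hj : j = m
  · subst hj
    simp
  · have : (j : ℕ) < m + 1 ↔ (j : ℕ) < m := by
      have := Fin.val_ne_iff.2 hj
      omega
    simp [hj, this]

/-- Weight `n ^ #σ` restricted to permutations fixing every point from `m` on. -/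
noncomputable def levelWeight {k : ℕ} (n m : ℕ) (σ : Equiv.Perm (Fin k)) : ℝ :=
  open Classical in
  if ∀ a : Fin k, m ≤ a → σ a = a then (n : ℝ) ^ cycleCount σ else 0

theorem levelWeight_self {k : ℕ} (n : ℕ) (σ : Equiv.Perm (Fin k)) :
    levelWeight n k σ = (n : ℝ) ^ cycleCount σ :=
  if_pos fun a h => absurd a.2 (not_lt.2 h)

theorem levelWeight_zero {k : ℕ} (n : ℕ) (σ : Equiv.Perm (Fin k)) :
    levelWeight n 0 σ = if σ = 1 then (n : ℝ) ^ k else 0 := by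
  have h : (∀ a : Fin k, 0 ≤ (a : ℕ) → σ a = a) ↔ σ = 1 := by
    simp [Equiv.ext_iff]
  unfold levelWeight
  rw [if_congr h rfl rfl]
  split_ifs with h1
  · subst h1
    simp [cycleCount]
  · rfl

/-- Jucys' factorization, one level at a time. -/
theorem levelWeight_succ {k : ℕ} (n : ℕ) (m : Fin k) (σ : Equiv.Perm (Fin k)) :
    n * levelWeight n (m + 1) σ = n * levelWeight n m σ +
      ∑ i ∈ Finset.univ.filter (· < m), levelWeight n m (Equiv.swap i m * σ) := by
  by_cases h : ∀ a : Fin k, (m : ℕ) + 1 ≤ a → σ a = a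
  · have hsum : ∀ i < m, σ m ≠ i → levelWeight n m (Equiv.swap i m * σ) = 0 := by
      intro i hi hne
      refine if_neg fun hh => hne ?_
      have := hh m le_rfl
      rw [Equiv.Perm.mul_apply, Equiv.swap_apply_eq_iff, Equiv.swap_apply_right] at this
      exact this
    have hle : σ m ≤ m := by
      by_contra hc
      have h1 := h (σ m) (by simpa using hc)
      have h2 := σ.injective h1
      exact hc h2.le
    have h0 : levelWeight n (m + 1) σ = (n : ℝ) ^ cycleCount σ := if_pos h
    rcases hle.eq_or_lt with he | hlt
    · have h1 : levelWeight n m σ = (n : ℝ) ^ cycleCount σ := by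
        refine if_pos fun a ha => ?_
        rcases ha.eq_or_lt with h2 | h2
        · rw [← Fin.ext h2, he]
        · exact h a h2
      rw [Finset.sum_eq_zero, h0, h1, add_zero]
      intro i hi
      have hi' := (Finset.mem_filter.1 hi).2
      exact hsum i hi' (by rw [he]; exact hi'.ne')
    · have h1 : levelWeight n m σ = 0 := if_neg fun hh => hlt.ne (hh m le_rfl)
      rw [Finset.sum_eq_single_of_mem (σ m) (by simpa using hlt), h0, h1, mul_zero, zero_add]
      · have hfix : (Equiv.swap (σ m) m * σ) m = m := by simp
        have h2 : levelWeight n m (Equiv.swap (σ m) m * σ) =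
            (n : ℝ) ^ cycleCount (Equiv.swap (σ m) m * σ) := by
          refine if_pos fun a ha => ?_
          rcases ha.eq_or_lt with h2 | h2
          · rw [← Fin.ext h2, hfix]
          · rw [Equiv.Perm.mul_apply, h a h2, Equiv.swap_apply_of_ne_of_ne]
            · exact (hlt.trans h2).ne'
            · exact (Fin.lt_def.2 h2).ne'
        have h3 := cycleCount_swap_mul hlt.ne hfix
        rw [← mul_assoc, Equiv.swap_mul_self, one_mul] at h3
        rw [h2, ← h3, pow_succ']
      · intro i hi hne
        exact hsum i (by simpa using hi) hne.symm
  · have hz : ∀ m' : ℕ, m' ≤ m + 1 → levelWeight n m' σ = 0 :=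
      fun m' hm' => if_neg fun hh => h fun a ha => hh a (hm'.trans ha)
    rw [hz _ le_rfl, hz m (by omega), Finset.sum_eq_zero]
    · simp
    · intro i hi
      have hi' : i < m := by simpa using hi
      refine if_neg fun hh => h fun a ha => ?_
      have h1 := hh a (by omega)
      rw [Equiv.Perm.mul_apply, Equiv.swap_apply_eq_iff, Equiv.swap_apply_of_ne_of_ne] at h1
      · exact h1
      · exact (hi'.trans ha).ne'
      · exact (Fin.lt_def.2 ha).ne'

theorem summable_boundedPsetCard {k n : ℕ} (hn : k * k < n) (m : ℕ) (σ : Equiv.Perm (Fin k)) :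
    Summable fun l : ℕ => (boundedPsetCard m l σ : ℝ) / (n : ℝ) ^ l := by
  have hn' : (k * k : ℝ) < n := by exact_mod_cast hn
  have hn0 : (0 : ℝ) < n := lt_of_le_of_lt (by positivity) hn'
  refine Summable.of_nonneg_of_le (fun l => by positivity) (fun l => ?_)
    (summable_geometric_of_lt_one (r := (k * k : ℝ) / n) (by positivity) ((div_lt_one hn0).2 hn'))
  rw [div_pow]
  gcongr
  exact_mod_cast boundedPsetCard_le m l σ

/-- Signed generating function of the bounded monotone factorizations, evaluated at `-1/n`. -/
noncomputable def signedSeries {k : ℕ} (n m : ℕ) (σ : Equiv.Perm (Fin k)) : ℝ :=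
  ∑' l : ℕ, (boundedPsetCard m l σ : ℝ) * (-1 : ℝ) ^ l / (n : ℝ) ^ l

theorem summable_signedSeries {k n : ℕ} (hn : k * k < n) (m : ℕ) (σ : Equiv.Perm (Fin k)) :
    Summable fun l : ℕ => (boundedPsetCard m l σ : ℝ) * (-1 : ℝ) ^ l / (n : ℝ) ^ l := by
  refine Summable.of_norm ((summable_boundedPsetCard hn m σ).congr fun l => ?_)
  simp

theorem signedSeries_zero {k : ℕ} (n : ℕ) (σ : Equiv.Perm (Fin k)) :
    signedSeries n 0 σ = if σ = 1 then 1 else 0 := by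
  unfold signedSeries
  rw [tsum_eq_single 0]
  · rw [boundedPsetCard_zero]
    split_ifs <;> simp
  · intro l hl
    obtain ⟨l, rfl⟩ := Nat.exists_eq_succ_of_ne_zero hl
    simp [boundedPsetCard_zero_succ]

/-- Right multiplication by `n + J_m` lowers the level of the signed series. -/
theorem signedSeries_succ {k n : ℕ} (hn : k * k < n) (m : Fin k) (σ : Equiv.Perm (Fin k)) :
    n * signedSeries n (m + 1) σ +
      ∑ i ∈ Finset.univ.filter (· < m), signedSeries n (m + 1) (σ * Equiv.swap i m) =
      n * signedSeries n m σ := by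
  have hn0 : (n : ℝ) ≠ 0 := Nat.cast_ne_zero.2 (by omega)
  have hs := fun m' (τ : Equiv.Perm (Fin k)) => summable_signedSeries hn m' τ
  have htail : ∀ l : ℕ,
      (boundedPsetCard (m + 1) (l + 1) σ : ℝ) * (-1 : ℝ) ^ (l + 1) / (n : ℝ) ^ (l + 1) =
      (boundedPsetCard m (l + 1) σ : ℝ) * (-1 : ℝ) ^ (l + 1) / (n : ℝ) ^ (l + 1) -
      (∑ i ∈ Finset.univ.filter (· < m), (boundedPsetCard (m + 1) l (σ * Equiv.swap i m) : ℝ) *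
        (-1 : ℝ) ^ l / (n : ℝ) ^ l) / n := by
    intro l
    rw [boundedPsetCard_succ_succ, ← Finset.sum_div, ← Finset.sum_mul]
    push_cast
    field_simp
    ring
  have hsum : Summable fun l : ℕ => ∑ i ∈ Finset.univ.filter (· < m),
      (boundedPsetCard (m + 1) l (σ * Equiv.swap i m) : ℝ) * (-1 : ℝ) ^ l / (n : ℝ) ^ l :=
    summable_sum fun i _ => hs _ _
  have hrec : signedSeries n (m + 1) σ = signedSeries n m σ -
      (∑ i ∈ Finset.univ.filter (· < m), signedSeries n (m + 1) (σ * Equiv.swap i m)) / n := by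
    unfold signedSeries
    rw [(hs _ σ).tsum_eq_zero_add, (hs m σ).tsum_eq_zero_add, tsum_congr htail,
      ((summable_nat_add_iff 1).2 (hs m σ)).tsum_sub (hsum.div_const _), tsum_div_const,
      Summable.tsum_finsetSum fun i _ => hs _ _, boundedPsetCard_zero, boundedPsetCard_zero]
    ring
  rw [hrec]
  field_simp
  ring

theorem sum_signedSeries_mul_levelWeight {k n : ℕ} (hn : k * k < n) (m : ℕ) (hm : m ≤ k)
    (σ : Equiv.Perm (Fin k)) :
    ∑ τ, signedSeries n m (σ * τ⁻¹) * levelWeight n m τ = if σ = 1 then (n : ℝ) ^ k else 0 := by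
  have hn0 : (n : ℝ) ≠ 0 := Nat.cast_ne_zero.2 (by omega)
  induction m with
  | zero =>
    simp [signedSeries_zero, levelWeight_zero]
  | succ m ih =>
    rw [← ih (by omega)]
    apply mul_left_cancel₀ hn0
    obtain ⟨m, rfl⟩ : ∃ m' : Fin k, (m' : ℕ) = m := ⟨⟨m, hm⟩, rfl⟩
    have hswap : ∀ i, ∑ τ, signedSeries n (m + 1) (σ * τ⁻¹) *
        levelWeight n m (Equiv.swap i m * τ) =
        ∑ τ, signedSeries n (m + 1) (σ * τ⁻¹ * Equiv.swap i m) * levelWeight n m τ := by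
      intro i
      refine Fintype.sum_equiv (Equiv.mulLeft (Equiv.swap i m)) _ _ fun τ => ?_
      simp [mul_assoc]
    calc (n : ℝ) * ∑ τ, signedSeries n (m + 1) (σ * τ⁻¹) * levelWeight n (m + 1) τ
        = ∑ τ, signedSeries n (m + 1) (σ * τ⁻¹) * (n * levelWeight n (m + 1) τ) := by
          rw [Finset.mul_sum]
          exact Finset.sum_congr rfl fun τ _ => by ring
      _ = ∑ τ, n * signedSeries n (m + 1) (σ * τ⁻¹) * levelWeight n m τ +
          ∑ i ∈ Finset.univ.filter (· < m), ∑ τ, signedSeries n (m + 1) (σ * τ⁻¹) *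
            levelWeight n m (Equiv.swap i m * τ) := by
          rw [Finset.sum_comm, ← Finset.sum_add_distrib]
          refine Finset.sum_congr rfl fun τ _ => ?_
          rw [levelWeight_succ, ← Finset.mul_sum]
          ring
      _ = ∑ τ, n * signedSeries n m (σ * τ⁻¹) * levelWeight n m τ := by
          rw [Finset.sum_congr rfl fun i _ => hswap i, Finset.sum_comm,
            ← Finset.sum_add_distrib]
          refine Finset.sum_congr rfl fun τ _ => ?_
          rw [← signedSeries_succ hn, ← Finset.sum_mul]
          ring
      _ = _ := by
          rw [Finset.mul_sum]
          exact Finset.sum_congr rfl fun τ _ => by ring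

theorem inv_gramMatrix {k n : ℕ} (hn : k * k < n) :
    (gramMatrix k n)⁻¹ =
      Matrix.of fun σ τ => ((n : ℝ) ^ k)⁻¹ * signedSeries n k (σ * τ⁻¹) := by
  have hn0 : (n : ℝ) ≠ 0 := Nat.cast_ne_zero.2 (by omega)
  apply Matrix.inv_eq_left_inv
  ext σ τ
  have h := sum_signedSeries_mul_levelWeight hn k le_rfl (σ * τ⁻¹)
  simp only [Matrix.mul_apply, Matrix.of_apply, gramMatrix, mul_assoc, ← Finset.mul_sum,
    Matrix.one_apply, ← levelWeight_self]
  rw [Fintype.sum_equiv (Equiv.mulRight τ⁻¹) _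
    (fun ρ => signedSeries n k (σ * τ⁻¹ * ρ⁻¹) * levelWeight n k ρ) fun ρ => by simp [mul_assoc],
    h, if_congr mul_inv_eq_one rfl rfl]
  split_ifs
  · exact inv_mul_cancel₀ (pow_ne_zero k hn0)
  · exact mul_zero _

/-- Monotone-factorization (Jucys–Murphy) expansion of the unitary Weingarten function:
for `n` large enough, `Σ_l #P(σ,l) n^{-l}` converges absolutely and
`Wg(n,σ) = n^{-k} Σ_{l≥0} #P(σ,l) (−1)^l n^{-l}`. -/
theorem stmt9 (k : ℕ) (hk : 1 ≤ k) (σ : Equiv.Perm (Fin k)) :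
    ∃ N : ℕ, ∀ n : ℕ, N ≤ n →
      Summable (fun l : ℕ => (PsetCard k σ l : ℝ) / (n : ℝ) ^ l) ∧
      Wg k n σ = ((n : ℝ) ^ k)⁻¹ *
        ∑' l : ℕ, (PsetCard k σ l : ℝ) * (-1 : ℝ) ^ l / (n : ℝ) ^ l := by
  refine ⟨k * k + 1, fun n hn => ⟨?_, ?_⟩⟩
  · simpa only [boundedPsetCard_self] using summable_boundedPsetCard (m := k) hn σ
  · rw [Wg, inv_gramMatrix hn, Matrix.of_apply, inv_one, mul_one, signedSeries]
    simp only [boundedPsetCard_self]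
end

section
/- Fix integers n ≥ k ≥ 1 and let γ = (1 2 ⋯ k) be the full cycle in the symmetric group S_k. Then the unitary Weingarten function satisfies the explicit formula Wg(n, γ) = (−1)^{k+1} · Cat_{k−1} / ((n−k+1)(n−k+2)⋯(n+k−1)), where Cat_m = binom(2m, m)/(m+1) is the m-th Catalan number and the denominator is the product of the 2k−1 consecutive integers from n−k+1 to n+k−1. -/
namespace Weingarten

open Equiv Equiv.Perm Finset

section Perm

variable {α : Type*} [Fintype α] [DecidableEq α]

/-- The reflection length of `σ`: the number of moved points minus the number of nontrivial
cycles. -/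
def reflLength (σ : Perm α) : ℕ := #σ.support - σ.cycleType.card

theorem card_cycleType_le (σ : Perm α) : σ.cycleType.card ≤ #σ.support := by
  rw [← σ.sum_cycleType]
  have h := Multiset.card_nsmul_le_sum (s := σ.cycleType) (a := 1)
    fun x hx => (one_lt_of_mem_cycleType hx).le
  simpa using h

theorem reflLength_one : reflLength (1 : Perm α) = 0 := by simp [reflLength]

theorem reflLength_conj (σ τ : Perm α) : reflLength (τ * σ * τ⁻¹) = reflLength σ := by
  simp [reflLength]

theorem reflLength_mul_of_disjoint {σ τ : Perm α} (h : σ.Disjoint τ) :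
    reflLength (σ * τ) = reflLength σ + reflLength τ := by
  have h1 := card_cycleType_le σ
  have h2 := card_cycleType_le τ
  simp only [reflLength, h.card_support_mul, h.cycleType_mul, Multiset.card_add]
  omega

theorem reflLength_of_isCycle {σ : Perm α} (h : σ.IsCycle) : reflLength σ = #σ.support - 1 := by
  rw [reflLength, card_cycleType_eq_one.2 h]

theorem sign_eq_neg_one_pow_reflLength (σ : Perm α) : (sign σ : ℤ) = (-1) ^ reflLength σ := by
  rw [sign_of_cycleType, sum_cycleType]
  have h := card_cycleType_le σ
  have : #σ.support + σ.cycleType.card = reflLength σ + 2 * σ.cycleType.card := by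
    unfold reflLength; omega
  rw [this, pow_add, pow_mul]
  simp

theorem reflLength_swap_apply_mul {τ : Perm α} {i : α} (hi : τ i ≠ i) :
    reflLength (swap i (τ i) * τ) + 1 = reflLength τ := by
  set c := τ.cycleOf i with hc
  have hci : c i = τ i := cycleOf_apply_self τ i
  have hcyc : c.IsCycle := isCycle_cycleOf τ hi
  have hmem : c ∈ τ.cycleFactorsFinset := by
    rw [cycleOf_mem_cycleFactorsFinset_iff]; exact mem_support.2 hi
  have hdis : Disjoint c (τ * c⁻¹) := (disjoint_mul_inv_of_mem_cycleFactorsFinset hmem).symm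
  have hτ : τ = c * (τ * c⁻¹) := by rw [hdis.commute.eq]; group
  have hi' : c i ≠ i := by rwa [hci]
  by_cases h2 : c (c i) = i
  · have hsw : c = swap i (c i) := hcyc.eq_swap_of_apply_apply_eq_self hi' h2
    have e : swap i (τ i) * τ = τ * c⁻¹ := by
      conv_lhs => rw [← hci, hτ, ← mul_assoc]
      rw [← hsw]
      nth_rw 1 [hsw]
      nth_rw 2 [hsw]
      simp
    rw [e]
    conv_rhs => rw [hτ, reflLength_mul_of_disjoint hdis, reflLength_of_isCycle hcyc]
    rw [hsw, card_support_swap hi'.symm]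
    omega
  · have hsupp := support_swap_mul_eq c i h2
    have hcyc' := hcyc.swap_mul hi' h2
    have hdis' : Disjoint (swap i (c i) * c) (τ * c⁻¹) := by
      rw [disjoint_iff_disjoint_support] at hdis ⊢
      rw [hsupp]
      exact hdis.mono_left sdiff_subset
    have e : swap i (τ i) * τ = (swap i (c i) * c) * (τ * c⁻¹) := by
      conv_lhs => rw [← hci, hτ, ← mul_assoc]
    rw [e, reflLength_mul_of_disjoint hdis']
    conv_rhs => rw [hτ, reflLength_mul_of_disjoint hdis]
    rw [reflLength_of_isCycle hcyc, reflLength_of_isCycle hcyc', hsupp,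
      card_sdiff_of_subset (by simpa using hi'), card_singleton]
    have := hcyc.two_le_card_support
    omega

theorem reflLength_swap_mul {π : Perm α} {l i : α} (hi : π i = i) (hl : l ≠ i) :
    reflLength (swap l i * π) = reflLength π + 1 := by
  have h : (swap l i * π) i = l := by simp [hi]
  have := reflLength_swap_apply_mul (τ := swap l i * π) (i := i) (by rwa [h])
  rw [h, swap_comm i l, ← mul_assoc, swap_mul_self, one_mul] at this
  exact this.symm

theorem cycleCount_add_reflLength {k : ℕ} (σ : Perm (Fin k)) :
    cycleCount σ + reflLength σ = k := by
  have h := card_cycleType_le σ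
  have h1 : (univ.filter fun a : Fin k => σ a = a) = σ.supportᶜ := by ext; simp
  have h2 : #σ.support ≤ k := by simpa using card_le_univ σ.support
  rw [cycleCount, h1, card_compl, Fintype.card_fin, reflLength]
  omega

end Perm

section Algebra

variable {α : Type*} [Fintype α] [DecidableEq α]

/-- The permutations supported in `R`. -/
def supportedIn (R : Finset α) : Finset (Perm α) := univ.filter fun σ => σ.support ⊆ R

theorem mem_supportedIn {R : Finset α} {σ : Perm α} : σ ∈ supportedIn R ↔ σ.support ⊆ R := by
  simp [supportedIn]

theorem apply_eq_of_mem_supportedIn {R : Finset α} {σ : Perm α} (h : σ ∈ supportedIn R) {i : α}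
    (hi : i ∉ R) : σ i = i :=
  notMem_support.1 fun h' => hi (mem_supportedIn.1 h h')

theorem swap_mul_mem_supportedIn {R : Finset α} {σ : Perm α} {x y : α} (h : σ ∈ supportedIn R)
    (hx : x ∈ R) (hy : y ∈ R) : swap x y * σ ∈ supportedIn R := by
  rw [mem_supportedIn] at *
  intro a ha
  by_contra haR
  have h1 : σ a = a := notMem_support.1 fun h' => haR (h h')
  refine mem_support.1 ha ?_
  rw [mul_apply, h1, swap_apply_of_ne_of_ne] <;> rintro rfl <;> contradiction

theorem inv_mem_supportedIn {R : Finset α} {σ : Perm α} (h : σ ∈ supportedIn R) :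
    σ⁻¹ ∈ supportedIn R := by
  rw [mem_supportedIn] at *
  rwa [support_inv]

theorem mul_mem_supportedIn {R : Finset α} {σ τ : Perm α} (hσ : σ ∈ supportedIn R)
    (hτ : τ ∈ supportedIn R) : σ * τ ∈ supportedIn R := by
  rw [mem_supportedIn] at *
  exact (support_mul_le σ τ).trans (union_subset hσ hτ)

theorem mapsTo_of_mem_supportedIn {R : Finset α} {σ : Perm α} (h : σ ∈ supportedIn R) {x : α}
    (hx : x ∈ R) : σ x ∈ R := by
  by_cases hσ : σ x = x
  · rwa [hσ]
  · exact mem_supportedIn.1 h (apply_mem_support.2 (mem_support.2 hσ))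

/-- A permutation supported in `insert i R` is uniquely `swap l i * π` with `l ∈ insert i R` and
`π` supported in `R`. -/
theorem sum_supportedIn_insert {M : Type*} [AddCommMonoid M] {R : Finset α} {i : α} (hi : i ∉ R)
    (f : Perm α → M) :
    ∑ σ ∈ supportedIn (insert i R), f σ =
      ∑ l ∈ insert i R, ∑ π ∈ supportedIn R, f (swap l i * π) := by
  rw [← sum_product']
  symm
  refine sum_bij' (fun p _ => swap p.1 i * p.2) (fun σ _ => (σ i, swap (σ i) i * σ)) ?_ ?_ ?_ ?_ ?_
  · rintro ⟨l, π⟩ h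
    obtain ⟨hl, hπ⟩ := mem_product.1 h
    refine swap_mul_mem_supportedIn ?_ hl (mem_insert_self i R)
    exact mem_supportedIn.2 ((mem_supportedIn.1 hπ).trans (subset_insert i R))
  · intro σ hσ
    have hσi := mapsTo_of_mem_supportedIn hσ (mem_insert_self i R)
    refine mem_product.2 ⟨hσi, mem_supportedIn.2 fun a ha => ?_⟩
    have h1 := mem_supportedIn.1 (swap_mul_mem_supportedIn hσ hσi (mem_insert_self i R)) ha
    refine (mem_insert.1 h1).resolve_left ?_
    rintro rfl
    simp at ha
  · rintro ⟨l, π⟩ h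
    obtain ⟨hl, hπ⟩ := mem_product.1 h
    have h1 : π i = i := apply_eq_of_mem_supportedIn hπ hi
    simp [h1]
  · intro σ _
    simp
  · intros; rfl

local notation "𝔸" => MonoidAlgebra ℝ (Perm α)

/-- The element `∑ z ^ |σ| σ` of the group algebra, over permutations supported in `R`. -/
noncomputable def reflSum (z : ℝ) (R : Finset α) : 𝔸 :=
  ∑ σ ∈ supportedIn R, MonoidAlgebra.single σ (z ^ reflLength σ)

/-- The Jucys–Murphy type element `∑_{l ∈ R} (l i)`. -/
noncomputable def jucysMurphy (R : Finset α) (i : α) : 𝔸 :=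
  ∑ l ∈ R, MonoidAlgebra.of ℝ (Perm α) (swap l i)

theorem reflSum_empty (z : ℝ) : reflSum z (∅ : Finset α) = 1 := by
  have : supportedIn (∅ : Finset α) = {1} := by
    ext σ; simp [mem_supportedIn]
  simp [reflSum, this, reflLength_one, ← MonoidAlgebra.one_def]

theorem reflSum_insert (z : ℝ) {R : Finset α} {i : α} (hi : i ∉ R) :
    reflSum z (insert i R) = (1 + z • jucysMurphy R i) * reflSum z R := by
  rw [reflSum, sum_supportedIn_insert hi, sum_insert hi, add_mul, one_mul]
  congr 1
  · rw [swap_self]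
    exact sum_congr rfl fun _ _ => rfl
  · simp only [jucysMurphy, reflSum, smul_sum, sum_mul_sum]
    refine sum_congr rfl fun l hl => sum_congr rfl fun π hπ => ?_
    rw [reflLength_swap_mul (apply_eq_of_mem_supportedIn hπ hi) (by rintro rfl; exact hi hl)]
    simp [MonoidAlgebra.single_mul_single, pow_succ']

theorem commute_jucysMurphy_of {R : Finset α} {i : α} (hi : i ∉ R) {σ : Perm α}
    (hσ : σ ∈ supportedIn R) :
    Commute (jucysMurphy R i) (MonoidAlgebra.of ℝ (Perm α) σ) := by
  have h1 : σ i = i := apply_eq_of_mem_supportedIn hσ hi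
  rw [Commute, SemiconjBy, jucysMurphy, sum_mul, mul_sum]
  symm
  refine sum_bij' (fun l _ => σ l) (fun l _ => σ⁻¹ l)
    (fun l hl => mapsTo_of_mem_supportedIn hσ hl)
    (fun l hl => mapsTo_of_mem_supportedIn (inv_mem_supportedIn hσ) hl) (by simp) (by simp) ?_
  intro l _
  rw [← map_mul, ← map_mul]
  congr 1
  have := mul_swap_eq_swap_mul σ l i
  rwa [h1] at this

theorem reflSum_eq (z : ℝ) (R : Finset α) : reflSum z R =
    ∑ σ ∈ supportedIn R, z ^ reflLength σ • MonoidAlgebra.of ℝ (Perm α) σ := by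
  simp [reflSum]

theorem commute_jucysMurphy_reflSum (z : ℝ) {R S : Finset α} {i : α} (hi : i ∉ R) (hS : S ⊆ R) :
    Commute (jucysMurphy R i) (reflSum z S) := by
  rw [reflSum_eq]
  refine Commute.sum_right _ _ _ fun σ hσ => Commute.smul_right (commute_jucysMurphy_of hi ?_) _
  exact mem_supportedIn.2 ((mem_supportedIn.1 hσ).trans hS)

theorem reflSum_insert' (z : ℝ) {R : Finset α} {i : α} (hi : i ∉ R) :
    reflSum z (insert i R) = reflSum z R * (1 + z • jucysMurphy R i) := by
  rw [reflSum_insert z hi]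
  exact (Commute.add_left (Commute.one_left _)
    ((commute_jucysMurphy_reflSum z hi subset_rfl).smul_left z)).eq

theorem commute_of_reflSum (z : ℝ) {R : Finset α} {σ : Perm α} (hσ : σ ∈ supportedIn R) :
    Commute (MonoidAlgebra.of ℝ (Perm α) σ) (reflSum z R) := by
  have hσ' := inv_mem_supportedIn hσ
  rw [Commute, SemiconjBy, reflSum_eq, sum_mul, mul_sum]
  refine sum_bij' (fun τ _ => σ * τ * σ⁻¹) (fun τ _ => σ⁻¹ * τ * σ)
    (fun τ h => mul_mem_supportedIn (mul_mem_supportedIn hσ h) hσ')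
    (fun τ h => mul_mem_supportedIn (mul_mem_supportedIn hσ' h) hσ) ?_ ?_ ?_
  · intros; group
  · intros; group
  · intro τ _
    rw [reflLength_conj, mul_smul_comm, smul_mul_assoc, ← map_mul, ← map_mul]
    congr 2
    group

theorem reflSum_one_mul_swap {R : Finset α} {x y : α} (hx : x ∈ R) (hy : y ∈ R) :
    reflSum 1 R * MonoidAlgebra.of ℝ (Perm α) (swap x y) = reflSum 1 R := by
  have hs : swap x y ∈ supportedIn R := by
    simpa using swap_mul_mem_supportedIn (σ := 1) (by simp [mem_supportedIn]) hx hy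
  simp only [reflSum_eq, sum_mul, one_pow, one_smul, ← map_mul]
  refine sum_bij' (fun τ _ => τ * swap x y) (fun τ _ => τ * swap x y)
    (fun τ h => mul_mem_supportedIn h hs) (fun τ h => mul_mem_supportedIn h hs) ?_ ?_ ?_ <;>
    simp [mul_assoc]

theorem swap_mul_reflSum_neg_one {R : Finset α} {x y : α} (hx : x ∈ R) (hy : y ∈ R) (hxy : x ≠ y) :
    MonoidAlgebra.of ℝ (Perm α) (swap x y) * reflSum (-1) R = -reflSum (-1) R := by
  have hsgn (σ : Perm α) : (-1 : ℝ) ^ reflLength σ = ((sign σ : ℤ) : ℝ) := by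
    rw [sign_eq_neg_one_pow_reflLength]; simp
  simp only [reflSum_eq, mul_sum, ← sum_neg_distrib, hsgn, mul_smul_comm, ← map_mul]
  refine sum_bij' (fun τ _ => swap x y * τ) (fun τ _ => swap x y * τ)
    (fun τ h => swap_mul_mem_supportedIn h hx hy) (fun τ h => swap_mul_mem_supportedIn h hx hy)
    ?_ ?_ ?_
  · simp
  · simp
  · intro τ _
    simp [sign_swap hxy]

theorem reflSum_one_mul_jucysMurphy {R S : Finset α} {i : α} (hi : i ∈ R) (hS : S ⊆ R) :
    reflSum 1 R * jucysMurphy S i = (#S : ℝ) • reflSum 1 R := by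
  rw [jucysMurphy, mul_sum, sum_congr rfl fun l hl => reflSum_one_mul_swap (hS hl) hi]
  simp [Nat.cast_smul_eq_nsmul]

theorem jucysMurphy_mul_reflSum_neg_one {R S : Finset α} {i : α} (hi : i ∈ R) (hS : S ⊆ R)
    (hiS : i ∉ S) : jucysMurphy S i * reflSum (-1) R = -((#S : ℝ) • reflSum (-1) R) := by
  rw [jucysMurphy, sum_mul, sum_congr rfl fun l hl =>
    swap_mul_reflSum_neg_one (hS hl) hi (by rintro rfl; exact hiS hl)]
  simp [Nat.cast_smul_eq_nsmul]

/-- For a row `R` and a column `C` sharing the corner `o`, transpositions between the rest of the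
row and the rest of the column act as zero. -/
theorem reflSum_mul_swap_mul_reflSum {R C : Finset α} {o l i : α} (hoR : o ∈ R) (hoC : o ∈ C)
    (hl : l ∈ R) (hi : i ∈ C) (hlo : l ≠ o) (hio : i ≠ o) :
    reflSum 1 R * MonoidAlgebra.of ℝ (Perm α) (swap l i) * reflSum (-1) C = 0 := by
  have e : swap l i * swap o i = swap o l * swap l i := by
    have := mul_swap_eq_swap_mul (swap l i) o i
    rwa [swap_apply_right, swap_apply_of_ne_of_ne hlo.symm hio.symm] at this
  have h1 : reflSum 1 R * MonoidAlgebra.of ℝ (Perm α) (swap l i) * reflSum (-1) C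
      = -(reflSum 1 R * MonoidAlgebra.of ℝ (Perm α) (swap l i) * reflSum (-1) C) := by
    conv_lhs => rw [← reflSum_one_mul_swap hoR hl, mul_assoc (reflSum 1 R), ← map_mul, ← e, map_mul,
      ← mul_assoc, mul_assoc _ _ (reflSum (-1) C), swap_mul_reflSum_neg_one hoC hi hio.symm]
    simp
  have h2 := eq_neg_iff_add_eq_zero.1 h1
  rw [← two_smul ℝ] at h2
  exact (smul_eq_zero_iff_right two_ne_zero).1 h2

theorem reflSum_one_mul_reflSum (z : ℝ) (R S : Finset α) (hS : S ⊆ R) :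
    reflSum 1 R * reflSum z S = (∏ i ∈ range #S, (1 + i * z)) • reflSum 1 R := by
  induction S using Finset.induction_on with
  | empty =>
    simp [reflSum_empty]
  | insert i S hi ih =>
    rw [insert_subset_iff] at hS
    rw [reflSum_insert z hi, ← mul_assoc, mul_add, mul_one, mul_smul_comm,
      reflSum_one_mul_jucysMurphy hS.1 hS.2, card_insert_of_notMem hi, prod_range_succ, add_mul,
      smul_mul_assoc, smul_mul_assoc, ih hS.2]
    module

theorem commute_reflSum (z y : ℝ) (R : Finset α) : Commute (reflSum z R) (reflSum y R) := by
  rw [reflSum_eq z]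
  exact Commute.sum_left _ _ _ fun σ hσ => (commute_of_reflSum y hσ).smul_left _

theorem reflSum_mul_hook_aux (z : ℝ) {R C : Finset α} {o : α} (hRC : R ∩ C = {o}) (D : Finset α)
    (hD : D ⊆ C.erase o) :
    reflSum z (R ∪ D) * (reflSum 1 R * reflSum (-1) C) =
      ((∏ i ∈ range #R, (1 + i * z)) * ∏ d ∈ range #D, (1 - (d + 1) * z)) •
        (reflSum 1 R * reflSum (-1) C) := by
  have ho : o ∈ R ∩ C := by simp [hRC]
  obtain ⟨hoR, hoC⟩ := mem_inter.1 ho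
  have hdisj {x : α} (hx : x ∈ C.erase o) : x ∉ R := fun hxR => by
    have : x ∈ R ∩ C := mem_inter.2 ⟨hxR, (mem_erase.1 hx).2⟩
    rw [hRC] at this
    exact (mem_erase.1 hx).1 (mem_singleton.1 this)
  induction D using Finset.induction_on with
  | empty =>
    rw [union_empty, ← mul_assoc, (commute_reflSum z 1 R).eq,
      reflSum_one_mul_reflSum z R R subset_rfl]
    simp
  | insert i D hi ih =>
    rw [insert_subset_iff] at hD
    have hiR : i ∉ R := hdisj hD.1
    have hiRD : i ∉ R ∪ D := by simp [hiR, hi]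
    obtain ⟨hio, hiC⟩ := mem_erase.1 hD.1
    have hoD : o ∉ D := fun h => (mem_erase.1 (hD.2 h)).1 rfl
    have hT : jucysMurphy (R ∪ D) i = jucysMurphy (R.erase o) i + jucysMurphy (insert o D) i := by
      rw [jucysMurphy, jucysMurphy, jucysMurphy, ← sum_union]
      · congr 1
        ext x
        by_cases hx : x = o <;> simp [hx, hoR]
      · rw [disjoint_left]
        intro x hx hx'
        rcases mem_insert.1 hx' with rfl | h
        · simp at hx
        · exact hdisj (hD.2 h) (mem_erase.1 hx).2
    have h0 : reflSum 1 R * jucysMurphy (R.erase o) i * reflSum (-1) C = 0 := by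
      rw [jucysMurphy, mul_sum, sum_mul]
      refine sum_eq_zero fun l hl => ?_
      obtain ⟨hlo, hlR⟩ := mem_erase.1 hl
      exact reflSum_mul_swap_mul_reflSum hoR hoC hlR hiC hlo hio
    have h1 : jucysMurphy (R ∪ D) i * (reflSum 1 R * reflSum (-1) C) =
        -((#D + 1 : ℝ) • (reflSum 1 R * reflSum (-1) C)) := by
      rw [← mul_assoc, (commute_jucysMurphy_reflSum 1 hiRD subset_union_left).eq, hT, mul_add,
        add_mul, h0, zero_add, mul_assoc, jucysMurphy_mul_reflSum_neg_one hiC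
          (insert_subset hoC fun x hx => (mem_erase.1 (hD.2 hx)).2) (by simp [hio, hi]),
        card_insert_of_notMem hoD]
      simp
    rw [union_insert, reflSum_insert' z hiRD, mul_assoc, add_mul, one_mul, smul_mul_assoc, h1,
      card_insert_of_notMem hi, prod_range_succ]
    simp only [mul_add, mul_smul_comm, mul_neg, smul_neg, ih hD.2]
    module

/-- The product of a row symmetrizer and a column antisymmetrizer of a hook is an eigenvector of
the sum of all permutations weighted by reflection length. -/
theorem reflSum_univ_mul_hook (z : ℝ) {R C : Finset α} {o : α} (hRC : R ∩ C = {o})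
    (hRC' : R ∪ C = univ) :
    reflSum z univ * (reflSum 1 R * reflSum (-1) C) =
      ((∏ i ∈ range #R, (1 + i * z)) * ∏ d ∈ range (#C - 1), (1 - (d + 1) * z)) •
        (reflSum 1 R * reflSum (-1) C) := by
  have ho : o ∈ R ∩ C := by simp [hRC]
  obtain ⟨hoR, hoC⟩ := mem_inter.1 ho
  have h := reflSum_mul_hook_aux z hRC (C.erase o) subset_rfl
  rwa [card_erase_of_mem hoC, show R ∪ C.erase o = univ by
    rw [← hRC']; ext x; by_cases hx : x = o <;> simp [hx, hoR]] at h

theorem coeff_hook_one {R C : Finset α} {o : α} (hRC : R ∩ C = {o}) :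
    (reflSum 1 R * reflSum (-1) C).coeff 1 = 1 := by
  have h1 (S : Finset α) : (1 : Perm α) ∈ supportedIn S := by simp [mem_supportedIn]
  have h2 {σ τ : Perm α} (hσ : σ ∈ supportedIn R) (hτ : τ ∈ supportedIn C) (h : σ * τ = 1) :
      σ = 1 := by
    have hσC : σ ∈ supportedIn C := by
      rw [eq_inv_of_mul_eq_one_left h]; exact inv_mem_supportedIn hτ
    have h3 : σ.support ⊆ {o} := by
      rw [← hRC]
      exact subset_inter (mem_supportedIn.1 hσ) (mem_supportedIn.1 hσC)
    exact card_support_le_one.1 (card_le_card h3)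
  simp only [reflSum, sum_mul_sum, MonoidAlgebra.single_mul_single, MonoidAlgebra.coeff_sum,
    MonoidAlgebra.coeff_single, Finsupp.finsetSum_apply, Finsupp.single_apply]
  rw [sum_eq_single_of_mem 1 (h1 R), sum_eq_single_of_mem 1 (h1 C)]
  · simp [reflLength_one]
  · intro τ _ hτ
    simp [hτ]
  · intro σ hσ hσ1
    refine sum_eq_zero fun τ hτ => if_neg fun h => hσ1 (h2 hσ hτ h)

theorem sameCycle_swap_mul {π : Perm α} {x y : α} (h : ¬ SameCycle π x y) :
    SameCycle (swap x y * π) x y := by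
  have key (n : ℕ) : SameCycle (swap x y * π) x ((π ^ n) x) := by
    induction n with
    | zero => exact SameCycle.refl _ _
    | succ n ih =>
      have e : (π ^ (n + 1)) x = π ((π ^ n) x) := by rw [pow_succ', mul_apply]
      by_cases hx : (π ^ (n + 1)) x = x
      · rw [hx]
      · have hy : (π ^ (n + 1)) x ≠ y := fun hy => h ⟨(n + 1 : ℕ), by rw [zpow_natCast, hy]⟩
        have : (π ^ (n + 1)) x = (swap x y * π) ((π ^ n) x) := by
          rw [mul_apply, ← e, swap_apply_of_ne_of_ne hx hy]
        rw [this, sameCycle_apply_right]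
        exact ih
  obtain ⟨n, hn⟩ := SameCycle.exists_nat_pow_eq (f := π) (x := x) (y := π⁻¹ x)
    ⟨-1, by simp⟩
  have h1 := key n
  rw [hn, ← sameCycle_apply_right] at h1
  simpa using h1

theorem sameCycle_swap_mul_of_sameCycle {π : Perm α} {x y a b : α} (h : ¬ SameCycle π x y)
    (hab : SameCycle π a b) : SameCycle (swap x y * π) a b := by
  have hxy := sameCycle_swap_mul h
  have step (c : α) : SameCycle (swap x y * π) c (π c) := by
    have h1 : SameCycle (swap x y * π) c ((swap x y * π) c) :=
      sameCycle_apply_right.2 (SameCycle.refl _ _)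
    rw [mul_apply] at h1
    refine h1.trans ?_
    by_cases hx : π c = x
    · rw [hx, swap_apply_left]; exact hxy.symm
    by_cases hy : π c = y
    · rw [hy, swap_apply_right]; exact hxy
    rw [swap_apply_of_ne_of_ne hx hy]
  obtain ⟨n, rfl⟩ := hab.exists_nat_pow_eq
  clear hab
  induction n with
  | zero => exact SameCycle.refl _ _
  | succ n ih =>
    rw [pow_succ', mul_apply]
    exact ih.trans (step _)

/-- `f` sends each point to the unique element of `P` in its `π`-cycle. -/
structure IsCycleLabelling (P : Finset α) (π : Perm α) (f : α → α) : Prop where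
  mem (a : α) : f a ∈ P
  apply_perm (a : α) : f (π a) = f a
  apply_of_mem {p : α} : p ∈ P → f p = p
  sameCycle (a : α) : SameCycle π (f a) a

theorem IsCycleLabelling.swap_mul {P : Finset α} {π : Perm α} {f : α → α} {i x : α}
    (h : IsCycleLabelling (insert i P) π f) (hi : i ∉ P) (hx : f x ∈ P) :
    IsCycleLabelling P (swap x i * π) fun a => if f a = i then f x else f a := by
  have hfi : f i = i := h.apply_of_mem (mem_insert_self i P)
  have hxi : f x ≠ i := fun hxi => hi (hxi ▸ hx)
  have hns : ¬ SameCycle π x i := fun hs => by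
    obtain ⟨n, hn⟩ := hs.exists_nat_pow_eq
    have (n : ℕ) : f ((π ^ n) x) = f x := by
      induction n with
      | zero => rfl
      | succ n ih => rw [pow_succ', mul_apply, h.apply_perm, ih]
    exact hxi (by rw [← this n, hn, hfi])
  refine ⟨fun a => ?_, fun a => ?_, fun {p} hp => ?_, fun a => ?_⟩
  · split_ifs with ha
    · exact hx
    · exact (mem_insert.1 (h.mem a)).resolve_left ha
  · have hsw (b : α) : (if f (swap x i b) = i then f x else f (swap x i b)) =
        if f b = i then f x else f b := by
      by_cases hb : b = x
      · subst hb; simp [hfi, hxi]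
      by_cases hb' : b = i
      · subst hb'; simp [hfi, hxi]
      rw [swap_apply_of_ne_of_ne hb hb']
    rw [mul_apply, hsw, h.apply_perm]
  · have h1 := h.apply_of_mem (mem_insert_of_mem hp)
    have h2 : p ≠ i := by rintro rfl; exact hi hp
    simp [h1, h2]
  · have h1 := sameCycle_swap_mul_of_sameCycle hns (h.sameCycle a)
    split_ifs with ha
    · rw [ha] at h1
      exact (sameCycle_swap_mul_of_sameCycle hns (h.sameCycle x)).trans ((sameCycle_swap_mul hns).trans h1)
    · exact h1

theorem hook_insert_identity {P S : Finset α} {o i : α} (ho : o ∉ P) (hi : i ∉ P) (hio : i ≠ o)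
    (hS : S ⊆ P) {w : Perm α} (hw : ∀ p ∈ insert i P, w p = p) (u : Perm α) :
    reflSum 1 (insert i (insert o (P \ S))) * MonoidAlgebra.of ℝ (Perm α) w *
        reflSum (-1) (insert o S) * MonoidAlgebra.of ℝ (Perm α) u -
      reflSum 1 (insert o (P \ S)) * MonoidAlgebra.of ℝ (Perm α) w *
        reflSum (-1) (insert i (insert o S)) * MonoidAlgebra.of ℝ (Perm α) u =
    reflSum 1 (insert o (P \ S)) * MonoidAlgebra.of ℝ (Perm α) (swap o i * w) *
        reflSum (-1) (insert o S) * MonoidAlgebra.of ℝ (Perm α) u +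
      ∑ l ∈ insert o P, reflSum 1 (insert o (P \ S)) * MonoidAlgebra.of ℝ (Perm α) w *
        reflSum (-1) (insert o S) * MonoidAlgebra.of ℝ (Perm α) (swap l i * u) := by
  have hiR : i ∉ insert o (P \ S) := by simp [hio, hi]
  have hiC : i ∉ insert o S := by simpa [hio] using fun h => hi (hS h)
  have hoP : o ∉ P \ S := by simp [ho]
  have hoS : o ∉ S := fun h => ho (hS h)
  have hiP : i ∉ insert o P := by simp [hio, hi]
  have hwi := hw i (mem_insert_self i P)
  have hc : Commute (jucysMurphy (P \ S) i) (MonoidAlgebra.of ℝ (Perm α) w) := by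
    refine Commute.sum_left _ _ _ fun l hl => ?_
    have hwl := hw l (mem_insert_of_mem (mem_sdiff.1 hl).1)
    have := mul_swap_eq_swap_mul w l i
    rw [hwl, hwi] at this
    rw [Commute, SemiconjBy, ← map_mul, ← map_mul, this]
  have hPS : jucysMurphy P i = jucysMurphy (P \ S) i + jucysMurphy S i := (sum_sdiff hS).symm
  have hT (Q : Finset α) (hQ : o ∉ Q) : jucysMurphy (insert o Q) i =
      MonoidAlgebra.of ℝ (Perm α) (swap o i) + jucysMurphy Q i := sum_insert hQ
  have hb := commute_jucysMurphy_reflSum (-1) hiP (insert_subset_insert o hS)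
  have hsum : ∑ l ∈ insert o P, reflSum 1 (insert o (P \ S)) * MonoidAlgebra.of ℝ (Perm α) w *
        reflSum (-1) (insert o S) * MonoidAlgebra.of ℝ (Perm α) (swap l i * u) =
      reflSum 1 (insert o (P \ S)) * MonoidAlgebra.of ℝ (Perm α) w *
        (jucysMurphy (insert o P) i * reflSum (-1) (insert o S)) *
          MonoidAlgebra.of ℝ (Perm α) u := by
    rw [hb.eq, jucysMurphy, mul_sum, mul_sum, sum_mul]
    simp only [map_mul, mul_assoc]
  rw [hsum, reflSum_insert' 1 hiR, reflSum_insert (-1) hiC, hT _ hoP, hT _ hoS, hT _ ho, hPS,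
    map_mul, ← sub_eq_zero]
  have hc' := hc.eq
  generalize reflSum 1 (insert o (P \ S)) = a
  generalize reflSum (-1) (insert o S) = b
  generalize jucysMurphy (P \ S) i = t at *
  generalize jucysMurphy S i = t'
  generalize MonoidAlgebra.of ℝ (Perm α) u = u'
  generalize MonoidAlgebra.of ℝ (Perm α) w = w' at *
  generalize MonoidAlgebra.of ℝ (Perm α) (swap o i) = s
  have : a * (t * w') * b * u' = a * (w' * t) * b * u' := by rw [hc']
  simp only [one_smul, neg_smul, mul_add, add_mul, mul_neg, neg_mul, mul_one, one_mul,
    mul_assoc] at this ⊢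
  rw [this]
  abel

/-- Alternating sum over hooks with corner `o`: a functional that is constant on full cycles picks out
that constant, with multiplicity `(#P + 1)!`. -/
theorem sum_hook_eq {φ : MonoidAlgebra ℝ (Perm α) →ₗ[ℝ] ℝ} {c : ℝ} {o : α}
    (hφ : ∀ σ, (∀ a, SameCycle σ o a) → φ (MonoidAlgebra.of ℝ (Perm α) σ) = c)
    (P : Finset α) (ho : o ∉ P) (w u : Perm α) (f : α → α) (hw : ∀ p ∈ P, w p = p)
    (hf : IsCycleLabelling (insert o P) (w * u) f) (hwo : f (w o) = o) :
    ∑ S ∈ P.powerset, (-1 : ℝ) ^ #S *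
      φ (reflSum 1 (insert o (P \ S)) * MonoidAlgebra.of ℝ (Perm α) w *
        reflSum (-1) (insert o S) * MonoidAlgebra.of ℝ (Perm α) u) =
      (#P + 1).factorial * c := by
  induction P using Finset.induction_on generalizing w u f with
  | empty =>
    have h1 : supportedIn {o} = {(1 : Perm α)} := by
      ext σ
      simp only [mem_supportedIn, mem_singleton]
      exact ⟨fun h => card_support_le_one.1 (card_le_card h), by rintro rfl; simp⟩
    have h2 (z : ℝ) : reflSum z {o} = 1 := by
      simp [reflSum, h1, reflLength_one, MonoidAlgebra.one_def]
    have h3 := hφ (w * u) fun a => by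
      have := hf.sameCycle a
      rwa [show f a = o by simpa using hf.mem a] at this
    simpa [h2] using h3
  | insert i P hi ih =>
    have hio : i ≠ o := by rintro rfl; simp at ho
    have ho' : o ∉ P := fun h => ho (mem_insert_of_mem h)
    have hiP : i ∉ insert o P := by simp [hio, hi]
    rw [insert_comm] at hf
    have hwP : ∀ p ∈ P, w p = p := fun p hp => hw p (mem_insert_of_mem hp)
    have hwi : w i = i := hw i (mem_insert_self i P)
    have hfo : f o = o := hf.apply_of_mem (by simp)
    have hfi : f i = i := hf.apply_of_mem (by simp)
    have hstep (S : Finset α) (hS : S ∈ P.powerset) := congrArg φ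
      (hook_insert_identity ho' hi hio (mem_powerset.1 hS) hw u)
    have hpair : ∑ S ∈ (insert i P).powerset, (-1 : ℝ) ^ #S *
        φ (reflSum 1 (insert o (insert i P \ S)) * MonoidAlgebra.of ℝ (Perm α) w *
          reflSum (-1) (insert o S) * MonoidAlgebra.of ℝ (Perm α) u) =
        ∑ S ∈ P.powerset, (-1 : ℝ) ^ #S *
          (φ (reflSum 1 (insert o (P \ S)) * MonoidAlgebra.of ℝ (Perm α) (swap o i * w) *
            reflSum (-1) (insert o S) * MonoidAlgebra.of ℝ (Perm α) u) +
          ∑ l ∈ insert o P, φ (reflSum 1 (insert o (P \ S)) * MonoidAlgebra.of ℝ (Perm α) w *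
            reflSum (-1) (insert o S) * MonoidAlgebra.of ℝ (Perm α) (swap l i * u))) := by
      rw [sum_powerset_insert hi, ← sum_add_distrib]
      refine sum_congr rfl fun S hS => ?_
      have hiS : i ∉ S := fun h => hi (mem_powerset.1 hS h)
      rw [← map_sum, ← map_add, ← hstep S hS, insert_sdiff_of_notMem _ hiS, insert_comm o i,
        insert_sdiff_insert, sdiff_insert_of_notMem hi, insert_comm o i, card_insert_of_notMem hiS,
        map_sub, pow_succ]
      ring
    rw [hpair]
    simp only [mul_add, sum_add_distrib, mul_sum]
    rw [sum_comm]
    have hswap : ∑ S ∈ P.powerset, (-1 : ℝ) ^ #S *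
          φ (reflSum 1 (insert o (P \ S)) * MonoidAlgebra.of ℝ (Perm α) (swap o i * w) *
            reflSum (-1) (insert o S) * MonoidAlgebra.of ℝ (Perm α) u) =
        (#P + 1).factorial * c := by
      refine ih ho' (swap o i * w) u (fun a => if f a = i then f o else f a) (fun p hp => ?_) ?_ ?_
      · rw [mul_apply, hwP p hp, swap_apply_of_ne_of_ne] <;> rintro rfl <;> contradiction
      · rw [mul_assoc]
        exact hf.swap_mul hiP (by simp [hfo])
      · rw [mul_apply]
        by_cases h1 : w o = o
        · simp [h1, hfi, hfo]
        · rw [swap_apply_of_ne_of_ne h1 (fun h2 => hio (by rw [← hwo, h2, hfi]))]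
          simp [hwo, hio.symm]
    have hrest (l : α) (hl : l ∈ insert o P) : ∑ S ∈ P.powerset, (-1 : ℝ) ^ #S *
          φ (reflSum 1 (insert o (P \ S)) * MonoidAlgebra.of ℝ (Perm α) w *
            reflSum (-1) (insert o S) * MonoidAlgebra.of ℝ (Perm α) (swap l i * u)) =
        (#P + 1).factorial * c := by
      have hfl : f (w l) = l := by
        rcases mem_insert.1 hl with rfl | h
        · exact hwo
        · rw [hwP l h, hf.apply_of_mem (by simp [h])]
      refine ih ho' w (swap l i * u) (fun a => if f a = i then f (w l) else f a) hwP ?_ ?_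
      · rw [← mul_assoc, mul_swap_eq_swap_mul, hwi, mul_assoc]
        exact hf.swap_mul hiP (by rwa [hfl])
      · simp [hwo, hio.symm]
    rw [hswap, sum_congr rfl hrest, sum_const, card_insert_of_notMem ho', card_insert_of_notMem hi,
      Nat.factorial_succ (#P + 1)]
    push_cast
    simp only [nsmul_eq_mul]
    push_cast
    ring

/-- The `ℓ¹` norm on the group algebra. -/
noncomputable def l1 (v : 𝔸) : ℝ := ∑ σ, |v.coeff σ|

theorem l1_of_mul (τ : Perm α) (v : 𝔸) : l1 (MonoidAlgebra.of ℝ (Perm α) τ * v) = l1 v := by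
  simp only [l1, MonoidAlgebra.of_apply, MonoidAlgebra.coeff_single_mul_apply, one_mul]
  exact Equiv.sum_comp (Equiv.mulLeft τ⁻¹) fun σ => |v.coeff σ|

theorem l1_sum_le {ι : Type*} (s : Finset ι) (v : ι → 𝔸) :
    l1 (∑ i ∈ s, v i) ≤ ∑ i ∈ s, l1 (v i) := by
  simp only [l1]
  rw [sum_comm]
  refine sum_le_sum fun σ _ => ?_
  rw [MonoidAlgebra.coeff_sum, Finsupp.finsetSum_apply]
  exact abs_sum_le_sum_abs _ _

theorem eq_zero_of_jucysMurphy_mul {z : ℝ} {R : Finset α} {i : α} (hz : |z| * #R < 1) {v : 𝔸}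
    (hv : (1 + z • jucysMurphy R i) * v = 0) : v = 0 := by
  have h1 : l1 (jucysMurphy R i * v) ≤ #R * l1 v := by
    rw [jucysMurphy, sum_mul]
    refine (l1_sum_le _ _).trans_eq ?_
    simp only [l1_of_mul, sum_const, nsmul_eq_mul]
  have h2 : l1 v = |z| * l1 (jucysMurphy R i * v) := by
    rw [add_mul, one_mul, smul_mul_assoc] at hv
    conv_lhs => rw [eq_neg_of_add_eq_zero_left hv]
    simp [l1, abs_mul, mul_sum]
  have h0 : 0 ≤ l1 v := sum_nonneg fun _ _ => abs_nonneg _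
  have h3 : l1 v = 0 := by
    have := mul_le_mul_of_nonneg_left h1 (abs_nonneg z)
    nlinarith
  ext σ
  have := (sum_eq_zero_iff_of_nonneg fun _ _ => abs_nonneg _).1 h3 σ (mem_univ σ)
  simpa using this

theorem eq_zero_of_reflSum_mul {z : ℝ} (hz : ∀ m < Fintype.card α, |z| * m < 1) (S : Finset α)
    {v : 𝔸} (hv : reflSum z S * v = 0) : v = 0 := by
  induction S using Finset.induction_on with
  | empty =>
    simpa [reflSum_empty] using hv
  | insert i S hi ih =>
    rw [reflSum_insert z hi, mul_assoc] at hv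
    refine ih (eq_zero_of_jucysMurphy_mul (hz _ ?_) hv)
    have := card_le_univ (insert i S)
    rw [card_insert_of_notMem hi] at this
    omega

end Algebra

section Weingarten

variable {k n : ℕ}

/-- The element of the group algebra with prescribed coefficients. -/
noncomputable def ofFun (v : Perm (Fin k) → ℝ) : MonoidAlgebra ℝ (Perm (Fin k)) :=
  ∑ σ, MonoidAlgebra.single σ (v σ)

theorem coeff_ofFun (v : Perm (Fin k) → ℝ) (σ : Perm (Fin k)) : (ofFun v).coeff σ = v σ := by
  simp [ofFun, MonoidAlgebra.coeff_sum, Finsupp.single_apply]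

theorem reflSum_univ_coeff (z : ℝ) (σ : Perm (Fin k)) :
    (reflSum z univ).coeff σ = z ^ reflLength σ := by
  have : supportedIn (univ : Finset (Fin k)) = univ := by ext; simp [mem_supportedIn]
  simp [reflSum, this, MonoidAlgebra.coeff_sum, Finsupp.single_apply]

/-- The group algebra element whose left multiplication is the Gram matrix. -/
noncomputable def gramElement (k n : ℕ) : MonoidAlgebra ℝ (Perm (Fin k)) :=
  (n : ℝ) ^ k • reflSum (n : ℝ)⁻¹ univ

theorem gramElement_coeff (hn : n ≠ 0) (σ : Perm (Fin k)) :
    (gramElement k n).coeff σ = (n : ℝ) ^ cycleCount σ := by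
  have hn' : (n : ℝ) ≠ 0 := Nat.cast_ne_zero.2 hn
  rw [gramElement, MonoidAlgebra.coeff_smul_apply, reflSum_univ_coeff, smul_eq_mul]
  have h : (n : ℝ) ^ k = (n : ℝ) ^ (cycleCount σ + reflLength σ) := by
    rw [cycleCount_add_reflLength]
  rw [h, pow_add, mul_assoc, ← mul_pow, mul_inv_cancel₀ hn', one_pow, mul_one]

theorem gramMatrix_mulVec (hn : n ≠ 0) (v : Perm (Fin k) → ℝ) :
    ofFun ((gramMatrix k n).mulVec v) = gramElement k n * ofFun v := by
  ext σ
  rw [coeff_ofFun, ofFun, mul_sum, MonoidAlgebra.coeff_sum, Finsupp.finsetSum_apply]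
  simp only [MonoidAlgebra.coeff_mul_single_apply, gramElement_coeff hn]
  rfl

theorem eq_zero_of_gramElement_mul (hk : 1 ≤ k) (hn : k ≤ n)
    {v : MonoidAlgebra ℝ (Perm (Fin k))} (hv : gramElement k n * v = 0) : v = 0 := by
  have hn0 : (0 : ℝ) < n := by exact_mod_cast hk.trans hn
  rw [gramElement, smul_mul_assoc, smul_eq_zero_iff_right (pow_ne_zero _ hn0.ne')] at hv
  refine eq_zero_of_reflSum_mul (fun m hm => ?_) univ hv
  rw [Fintype.card_fin] at hm
  rw [abs_of_pos (inv_pos.2 hn0), inv_mul_lt_one₀ hn0]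
  exact_mod_cast hm.trans_le hn

theorem gramElement_mul_Wg (hk : 1 ≤ k) (hn : k ≤ n) : gramElement k n * ofFun (Wg k n) = 1 := by
  have hn0 : n ≠ 0 := by omega
  have hinj : Function.Injective (gramMatrix k n).mulVec := by
    intro v w h
    have h1 : gramElement k n * (ofFun v - ofFun w) = 0 := by
      rw [mul_sub, ← gramMatrix_mulVec hn0, ← gramMatrix_mulVec hn0, h, sub_self]
    have h2 := sub_eq_zero.1 (eq_zero_of_gramElement_mul hk hn h1)
    ext σ
    rw [← coeff_ofFun v, h2, coeff_ofFun]
  have hunit : IsUnit (gramMatrix k n).det :=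
    (Matrix.isUnit_iff_isUnit_det _).1 (Matrix.mulVec_injective_iff_isUnit.1 hinj)
  rw [← gramMatrix_mulVec hn0]
  ext σ
  rw [coeff_ofFun]
  have h := congrFun (congrFun (Matrix.mul_nonsing_inv _ hunit) σ) 1
  rw [Matrix.mul_apply] at h
  refine h.trans ?_
  simp [Matrix.one_apply, MonoidAlgebra.one_def, Finsupp.single_apply, eq_comm]

theorem commute_of_gramElement (σ : Perm (Fin k)) :
    Commute (MonoidAlgebra.of ℝ (Perm (Fin k)) σ) (gramElement k n) :=
  (commute_of_reflSum _ (by simp [mem_supportedIn])).smul_right _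

theorem commute_of_Wg (hk : 1 ≤ k) (hn : k ≤ n) (σ : Perm (Fin k)) :
    Commute (MonoidAlgebra.of ℝ (Perm (Fin k)) σ) (ofFun (Wg k n)) := by
  have hW := gramElement_mul_Wg hk hn
  refine sub_eq_zero.1 (eq_zero_of_gramElement_mul hk hn ?_)
  rw [mul_sub, ← mul_assoc, ← mul_assoc, hW, ← (commute_of_gramElement σ).eq, mul_assoc, hW,
    mul_one, one_mul, sub_self]

theorem Wg_mul_gramElement (hk : 1 ≤ k) (hn : k ≤ n) :
    ofFun (Wg k n) * gramElement k n = 1 := by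
  refine sub_eq_zero.1 (eq_zero_of_gramElement_mul hk hn ?_)
  rw [mul_sub, ← mul_assoc, gramElement_mul_Wg hk hn, one_mul, mul_one, sub_self]

theorem Wg_eq_of_isConj (hk : 1 ≤ k) (hn : k ≤ n) {σ τ : Perm (Fin k)} (h : IsConj σ τ) :
    Wg k n σ = Wg k n τ := by
  obtain ⟨c, rfl⟩ := isConj_iff.1 h
  have := congrArg (fun x => x.coeff (c * σ)) (commute_of_Wg hk hn c).eq
  simpa [MonoidAlgebra.coeff_single_mul_apply, MonoidAlgebra.coeff_mul_single_apply, coeff_ofFun]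
    using this

theorem isConj_of_forall_sameCycle {α : Type*} [Fintype α] [DecidableEq α] {σ τ : Perm α} {x y : α}
    (hσ : ∀ a, SameCycle σ x a) (hτ : ∀ a, SameCycle τ y a) : IsConj σ τ := by
  rcases subsingleton_or_nontrivial α with hα | hα
  · rw [Subsingleton.elim σ τ]
  have key {σ : Perm α} {x : α} (hσ : ∀ a, SameCycle σ x a) : σ.IsCycle ∧ σ.support = univ := by
    have hx (a : α) : σ a ≠ a := fun ha => by
      obtain ⟨b, hb⟩ := exists_ne a
      have : SameCycle σ a b := (hσ a).symm.trans (hσ b)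
      exact hb ((this.eq_of_left ha).symm)
    exact ⟨⟨x, hx x, fun a _ => hσ a⟩, by ext a; simp [hx a]⟩
  obtain ⟨h1, h2⟩ := key hσ
  obtain ⟨h3, h4⟩ := key hτ
  exact h1.isConj h3 (by rw [h2, h4])

theorem sameCycle_finRotate {m : ℕ} (a : Fin (m + 1)) : SameCycle (finRotate (m + 1)) 0 a := by
  refine ⟨(a : ℕ), ?_⟩
  rw [zpow_natCast]
  induction a using Fin.induction with
  | zero => rfl
  | succ i ih =>
    rw [Fin.val_succ, pow_succ', mul_apply]
    simp at ih
    rw [ih]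
    simp

/-- The linear functional `x ↦ (Wg * x)(1)`. -/
noncomputable def WgFunctional (k n : ℕ) : MonoidAlgebra ℝ (Perm (Fin k)) →ₗ[ℝ] ℝ where
  toFun x := (ofFun (Wg k n) * x).coeff 1
  map_add' x y := by simp [mul_add]
  map_smul' c x := by simp

theorem WgFunctional_of (σ : Perm (Fin k)) :
    WgFunctional k n (MonoidAlgebra.of ℝ (Perm (Fin k)) σ) = Wg k n σ⁻¹ := by
  simp [WgFunctional, MonoidAlgebra.coeff_mul_single_apply, coeff_ofFun]

theorem prod_eq_prod_shift (x : ℝ) (hx : x ≠ 0) {m j : ℕ} (hj : j ≤ m) :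
    x ^ (m + 1) * ((∏ i ∈ range (m - j + 1), (1 + i * x⁻¹)) *
      ∏ d ∈ range j, (1 - (d + 1) * x⁻¹)) = ∏ i ∈ range (m + 1), (x - j + i) := by
  have e : m + 1 = j + (m - j + 1) := by omega
  have h1 : ∏ i ∈ range (m - j + 1), (x - j + (j + i : ℕ)) =
      x ^ (m - j + 1) * ∏ i ∈ range (m - j + 1), (1 + i * x⁻¹) := by
    rw [show x ^ (m - j + 1) = ∏ _ ∈ range (m - j + 1), x by simp, ← prod_mul_distrib]
    refine prod_congr rfl fun i _ => ?_
    push_cast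
    field_simp
    ring
  have h2 : ∏ i ∈ range j, (x - j + i) = x ^ j * ∏ d ∈ range j, (1 - (d + 1) * x⁻¹) := by
    rw [← prod_range_reflect]
    rw [show x ^ j = ∏ _ ∈ range j, x by simp, ← prod_mul_distrib]
    refine prod_congr rfl fun i hi => ?_
    have hi := mem_range.1 hi
    rw [show j - 1 - i = j - (i + 1) by omega, Nat.cast_sub (by omega)]
    push_cast
    field_simp
    ring
  have h3 : ∏ i ∈ range (m + 1), (x - j + i) =
      (∏ i ∈ range j, (x - j + i)) * ∏ i ∈ range (m - j + 1), (x - j + (j + i : ℕ)) := by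
    rw [← prod_range_add (fun i : ℕ => x - j + i), ← e]
  rw [h3, h1, h2, show x ^ (m + 1) = x ^ j * x ^ (m - j + 1) by rw [← pow_add, ← e]]
  ring

theorem WgFunctional_hook (hk : 1 ≤ k) (hn : k ≤ n) {R C : Finset (Fin k)} {o : Fin k}
    (hRC : R ∩ C = {o}) (hRC' : R ∪ C = univ) :
    WgFunctional k n (reflSum 1 R * reflSum (-1) C) =
      ((n : ℝ) ^ k * ((∏ i ∈ range #R, (1 + i * (n : ℝ)⁻¹)) *
        ∏ d ∈ range (#C - 1), (1 - (d + 1) * (n : ℝ)⁻¹)))⁻¹ := by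
  have h := congrArg (fun x => (ofFun (Wg k n) * ((n : ℝ) ^ k • x)).coeff 1)
    (reflSum_univ_mul_hook (n : ℝ)⁻¹ hRC hRC')
  rw [← smul_mul_assoc, ← gramElement, ← mul_assoc, Wg_mul_gramElement hk hn, one_mul,
    coeff_hook_one hRC] at h
  refine eq_inv_of_mul_eq_one_right ?_
  simpa [WgFunctional, mul_assoc] using h.symm

theorem fwdDiff_iter_inv_prod (r m : ℕ) {y : ℝ} (hy : 0 < y) :
    (fwdDiff (1 : ℝ))^[m] (fun y => (∏ i ∈ range r, (y + i))⁻¹) y =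
      (-1) ^ m * r.ascFactorial m * (∏ i ∈ range (r + m), (y + i))⁻¹ := by
  induction m generalizing y with
  | zero => simp
  | succ m ih =>
    rw [Function.iterate_succ_apply', fwdDiff, ih hy, ih (by positivity), Nat.ascFactorial_succ]
    have hp (t : ℕ) : ∏ i ∈ range t, (y + 1 + i) ≠ 0 :=
      prod_ne_zero_iff.2 fun i _ => by positivity
    have h1 : ∏ i ∈ range (r + m + 1), (y + i) = (∏ i ∈ range (r + m), (y + i)) * (y + (r + m)) := by
      rw [prod_range_succ]; push_cast; rfl
    have h2 : ∏ i ∈ range (r + m + 1), (y + i) = (∏ i ∈ range (r + m), (y + 1 + i)) * y := by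
      rw [prod_range_succ']
      simp only [Nat.cast_zero, add_zero]
      congr 1
      refine prod_congr rfl fun i _ => ?_
      push_cast; ring
    have h0 : y + (r + m) ≠ 0 := by positivity
    have e1 : (∏ i ∈ range (r + m), (y + i))⁻¹ =
        (y + (r + m)) * (∏ i ∈ range (r + m + 1), (y + i))⁻¹ := by
      rw [h1, mul_inv]; field_simp
    have e2 : (∏ i ∈ range (r + m), (y + 1 + i))⁻¹ =
        y * (∏ i ∈ range (r + m + 1), (y + i))⁻¹ := by
      rw [h2, mul_inv]; field_simp
    rw [e1, e2, ← add_assoc]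
    generalize (∏ i ∈ range (r + m + 1), (y + i))⁻¹ = p
    push_cast
    ring

theorem sum_choose_inv_prod (m : ℕ) {x : ℝ} (hx : m < x) :
    ∑ j ∈ range (m + 1), (m.choose j : ℝ) * ((-1) ^ j * (∏ i ∈ range (m + 1), (x - j + i))⁻¹) =
      (-1) ^ m * (m + 1).ascFactorial m * (∏ i ∈ range (2 * m + 1), (x - m + i))⁻¹ := by
  have h := fwdDiff_iter_inv_prod (m + 1) m (sub_pos.2 hx)
  rw [show m + 1 + m = 2 * m + 1 by ring] at h
  rw [← h, fwdDiff_iter_eq_sum_shift, ← sum_range_reflect]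
  refine sum_congr rfl fun j hj => ?_
  have hj : j ≤ m := Nat.lt_succ_iff.1 (mem_range.1 hj)
  have e : x - ((m - j : ℕ) : ℝ) = x - m + j := by rw [Nat.cast_sub hj]; ring
  rw [show m + 1 - 1 - j = m - j by omega, Nat.choose_symm hj, e, zsmul_eq_mul]
  push_cast
  simp only [nsmul_eq_mul, mul_one]
  ring

theorem catalan_mul_factorial (m : ℕ) : catalan m * (m + 1).factorial = (m + 1).ascFactorial m := by
  have h1 := Nat.factorial_mul_ascFactorial m m
  have h2 := succ_mul_catalan_eq_centralBinom m
  have h3 := Nat.choose_mul_factorial_mul_factorial (n := 2 * m) (k := m) (by omega)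
  rw [← Nat.centralBinom_eq_two_mul_choose, ← h2, show 2 * m - m = m by omega] at h3
  refine Nat.eq_of_mul_eq_mul_left m.factorial_pos ?_
  rw [h1, ← two_mul, ← h3, Nat.factorial_succ]
  ring

end Weingarten

end Weingarten

open Weingarten in
/-- Explicit formula for the Weingarten function of the full cycle `(1 2 ⋯ k)`:
`Wg(n, (1⋯k)) = (−1)^{k+1} Cat_{k−1} / ((n−k+1)(n−k+2)⋯(n+k−1))`. -/
theorem stmt10 (k n : ℕ) (hk : 1 ≤ k) (hn : k ≤ n) :
    Wg k n (finRotate k) =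
      ((-1 : ℝ) ^ (k + 1) * (catalan (k - 1) : ℝ)) /
        ∏ i ∈ Finset.range (2 * k - 1), ((n : ℝ) - (k : ℝ) + 1 + (i : ℝ)) := by
  obtain ⟨m, rfl⟩ := Nat.exists_eq_add_of_le' hk
  have hm : (m : ℝ) < n := by exact_mod_cast hn
  have hn0 : (n : ℝ) ≠ 0 := (lt_of_le_of_lt (Nat.cast_nonneg m) hm).ne'
  set P : Finset (Fin (m + 1)) := Finset.univ.erase 0 with hP
  have hcard : P.card = m := by simp [hP]
  have h := sum_hook_eq (φ := WgFunctional (m + 1) n) (c := Wg (m + 1) n (finRotate (m + 1)))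
    (o := 0) (fun σ hσ => by
      rw [WgFunctional_of]
      exact Wg_eq_of_isConj hk hn
        (isConj_of_forall_sameCycle (fun a => (hσ a).inv) sameCycle_finRotate))
    P (by simp [hP]) 1 1 id (fun _ _ => rfl)
    ⟨fun a => by by_cases ha : a = 0 <;> simp [hP, ha], fun a => by simp, fun _ => rfl,
      fun a => Equiv.Perm.SameCycle.refl _ _⟩ rfl
  have hterm (S : Finset (Fin (m + 1))) (hS : S ∈ P.powerset) :
      WgFunctional (m + 1) n (reflSum 1 (insert 0 (P \ S)) * MonoidAlgebra.of ℝ _ 1 *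
        reflSum (-1) (insert 0 S) * MonoidAlgebra.of ℝ _ 1) =
      (∏ i ∈ Finset.range (m + 1), ((n : ℝ) - S.card + i))⁻¹ := by
    have hSP := Finset.mem_powerset.1 hS
    have h0S : (0 : Fin (m + 1)) ∉ S := fun h => by simpa [hP] using hSP h
    have hSm : S.card ≤ m := (Finset.card_le_card hSP).trans_eq hcard
    rw [map_one, mul_one, mul_one, WgFunctional_hook hk hn (o := 0),
      Finset.card_insert_of_notMem h0S, Finset.card_insert_of_notMem (by simp [hP]),
      Finset.card_sdiff_of_subset hSP, hcard, Nat.add_sub_cancel, prod_eq_prod_shift _ hn0 hSm]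
    · ext a
      by_cases ha : a = 0 <;> simp [ha, hP]
    · ext a
      by_cases ha : a = 0 <;> by_cases ha' : a ∈ S <;> simp [ha, ha', hP]
  rw [Finset.sum_congr rfl fun S hS => by rw [hterm S hS], Finset.sum_powerset_apply_card
    fun j => (-1 : ℝ) ^ j * (∏ i ∈ Finset.range (m + 1), ((n : ℝ) - j + i))⁻¹, hcard] at h
  simp only [nsmul_eq_mul] at h
  rw [sum_choose_inv_prod m hm, ← catalan_mul_factorial] at h
  have hf : ((m + 1).factorial : ℝ) ≠ 0 := by positivity
  refine mul_left_cancel₀ hf ?_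
  rw [← h, show 2 * (m + 1) - 1 = 2 * m + 1 by omega, Nat.add_sub_cancel, div_eq_mul_inv]
  have e : ∏ i ∈ Finset.range (2 * m + 1), ((n : ℝ) - ((m + 1 : ℕ) : ℝ) + 1 + i) =
      ∏ i ∈ Finset.range (2 * m + 1), ((n : ℝ) - m + i) :=
    Finset.prod_congr rfl fun i _ => by push_cast; ring
  rw [e]
  push_cast
  ring
end
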